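/- arXiv:1708.00934 — 4 statements merged into one kernel-verified Lean document; each statement's English description precedes it below -/
import Mathlib

section
/- Let T be a tree. Then there exists a maximum matching M of T containing no connection edge, where a connection edge of T is an edge with exactly one endpoint in the closed neighborhood N[Supp(T)]. -/
open scoped Classical

namespace NullDecomp

variable {V : Type*}

/-- The null space of the real adjacency matrix of a graph. -/
def nullSpace [Fintype V] (G : SimpleGraph V) : Set (V → ℝ) :=
  {x | Matrix.mulVec (G.adjMatrix ℝ) x = 0}

/-- The support of the null space: vertices with a nonzero entry in some null vector. -/
def supportSet [Fintype V] (G : SimpleGraph V) : Set V :=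
  {v | ∃ x ∈ nullSpace G, x v ≠ 0}

/-- The (open) neighborhood of a set of vertices. -/
def nbhdSet (G : SimpleGraph V) (A : Set V) : Set V :=
  {v | ∃ u ∈ A, G.Adj u v}

/-- The closed neighborhood of a set of vertices. -/
def closedNbhd (G : SimpleGraph V) (A : Set V) : Set V :=
  A ∪ nbhdSet G A

/-- The core of a graph: the neighborhood of the support of the null space. -/
def coreSet [Fintype V] (G : SimpleGraph V) : Set V :=
  nbhdSet G (supportSet G)

/-- A tree is an S-tree if the closed neighborhood of its support is everything. -/
def IsSTree [Fintype V] (G : SimpleGraph V) : Prop :=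
  G.IsTree ∧ closedNbhd G (supportSet G) = Set.univ

/-- A matching: a set of edges of `G`, pairwise disjoint. -/
def IsMatchingSet (G : SimpleGraph V) (M : Finset (Sym2 V)) : Prop :=
  (↑M : Set (Sym2 V)) ⊆ G.edgeSet ∧
    ∀ e ∈ M, ∀ f ∈ M, e ≠ f → ∀ v : V, v ∈ e → v ∉ f

/-- A maximum matching. -/
def IsMaxMatching [Fintype V] (G : SimpleGraph V) (M : Finset (Sym2 V)) : Prop :=
  IsMatchingSet G M ∧ ∀ M' : Finset (Sym2 V), IsMatchingSet G M' → M'.card ≤ M.card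

/-- The matching number. -/
noncomputable def matchingNumber [Fintype V] (G : SimpleGraph V) : ℕ :=
  sSup {n | ∃ M : Finset (Sym2 V), IsMatchingSet G M ∧ M.card = n}

/-- An independent set of vertices. -/
def IsIndep (G : SimpleGraph V) (A : Set V) : Prop :=
  ∀ u ∈ A, ∀ w ∈ A, ¬ G.Adj u w

/-- The independence number. -/
noncomputable def indepNumber [Fintype V] (G : SimpleGraph V) : ℕ :=
  sSup {n | ∃ A : Set V, IsIndep G A ∧ A.ncard = n}

/-- A vertex cover. -/
def IsVertexCover (G : SimpleGraph V) (Cs : Set V) : Prop :=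
  ∀ e ∈ G.edgeSet, ∃ v ∈ Cs, v ∈ e

/-- The vertex cover number. -/
noncomputable def coverNumber [Fintype V] (G : SimpleGraph V) : ℕ :=
  sInf {n | ∃ Cs : Set V, IsVertexCover G Cs ∧ Cs.ncard = n}

/-- The nullity of a graph: dimension of the kernel of its adjacency matrix. -/
noncomputable def nullity [Fintype V] (G : SimpleGraph V) : ℕ :=
  Module.finrank ℝ (LinearMap.ker (Matrix.mulVecLin (G.adjMatrix ℝ)))

/-- The number of maximum matchings of a graph. -/
noncomputable def numMaxMatchings [Fintype V] (G : SimpleGraph V) : ℕ :=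
  Set.ncard {M : Finset (Sym2 V) | IsMaxMatching G M}

/-- `C` is (the vertex set of) a connected component of the subgraph of `T`
induced by the closed neighborhood of the support of `T`. -/
def IsSComponent [Fintype V] (T : SimpleGraph V) (C : Set V) : Prop :=
  ∃ c : (T.induce (closedNbhd T (supportSet T))).ConnectedComponent,
    C = Subtype.val '' c.supp

/-- `C` is (the vertex set of) a connected component of the subgraph of `T`
induced by the complement of the closed neighborhood of the support of `T`. -/
def IsNComponent [Fintype V] (T : SimpleGraph V) (C : Set V) : Prop :=
  ∃ c : (T.induce ((closedNbhd T (supportSet T))ᶜ)).ConnectedComponent,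
    C = Subtype.val '' c.supp

/-- The zero-extension to `ℝ^V` of the null space of the subgraph of `T` induced by `C`:
vectors vanishing outside `C` whose restriction to `C` is a null vector of `T.induce C`. -/
noncomputable def extNull [Fintype V] (T : SimpleGraph V) (C : Set V) : Submodule ℝ (V → ℝ) :=
  LinearMap.ker ((Matrix.mulVecLin ((T.induce C).adjMatrix ℝ)).comp
      (LinearMap.funLeft ℝ ℝ (Subtype.val : ↥C → V))) ⊓
  LinearMap.ker (LinearMap.funLeft ℝ ℝ (Subtype.val : ↥(Cᶜ) → V))

theorem mem_nullSpace_iff [Fintype V] {G : SimpleGraph V} {x : V → ℝ} :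
    x ∈ nullSpace G ↔ ∀ v, ∑ u, (if G.Adj v u then x u else 0) = 0 := by
  simp only [nullSpace, Set.mem_ofPred_eq, funext_iff, Matrix.mulVec, dotProduct,
    SimpleGraph.adjMatrix_apply, ite_mul, one_mul, zero_mul, Pi.zero_apply]

/-- Null vectors of a bipartite graph can be restricted to one colour class. -/
theorem indicator_color_mem_nullSpace [Fintype V] {G : SimpleGraph V} (C : G.Coloring (Fin 2))
    {x : V → ℝ} (hx : x ∈ nullSpace G) (i : Fin 2) :
    (fun v => if C v = i then x v else 0) ∈ nullSpace G := by
  rw [mem_nullSpace_iff] at hx ⊢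
  intro v
  by_cases hv : C v = i
  · refine Finset.sum_eq_zero fun u _ => ?_
    have := fun h : G.Adj v u => C.valid h
    grind
  · refine (Finset.sum_congr rfl fun u _ => ?_).trans (hx v)
    have := fun h : G.Adj v u => C.valid h
    split_ifs with h h'
    · rfl
    · have := this h
      omega
    · rfl

/-- If `C` is a vertex set whose only boundary edge is `uv`, then two null vectors are
proportional on that edge. -/
theorem nullSpace_mul_eq_mul_of_isolated_edge [Fintype V] {G : SimpleGraph V} {x y : V → ℝ}
    (hx : x ∈ nullSpace G) (hy : y ∈ nullSpace G) {u v : V} (huv : G.Adj u v) {C : Set V}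
    (hu : u ∈ C) (hv : v ∉ C) (hC : ∀ w ∈ C, ∀ z ∉ C, G.Adj w z → w = u ∧ z = v) :
    x u * y v = y u * x v := by
  rw [mem_nullSpace_iff] at hx hy
  set F : V → V → ℝ := fun w z => if G.Adj w z then x w * y z - y w * x z else 0 with hF
  have hrow : ∀ w, ∑ z, F w z = 0 := fun w => by
    have : ∑ z, F w z = x w * ∑ z, (if G.Adj w z then y z else 0)
        - y w * ∑ z, (if G.Adj w z then x z else 0) := by
      rw [Finset.mul_sum, Finset.mul_sum, ← Finset.sum_sub_distrib]
      refine Finset.sum_congr rfl fun z _ => ?_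
      simp only [hF]
      split_ifs <;> simp
    rw [this, hx, hy]
    simp
  have hanti : ∀ w z, F w z = -F z w := fun w z => by
    simp only [hF, G.adj_comm w z]
    split_ifs <;> ring
  set I : Finset V := Finset.univ.filter (· ∈ C) with hI
  have hin : ∑ w ∈ I, ∑ z ∈ I, F w z = 0 := by
    have h : ∑ w ∈ I, ∑ z ∈ I, F w z = -∑ w ∈ I, ∑ z ∈ I, F w z := by
      conv_lhs => rw [Finset.sum_comm]
      rw [← Finset.sum_neg_distrib]
      refine Finset.sum_congr rfl fun w _ => ?_
      rw [← Finset.sum_neg_distrib]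
      exact Finset.sum_congr rfl fun z _ => hanti z w
    linarith
  have hout : ∑ w ∈ I, ∑ z ∈ Iᶜ, F w z = F u v := by
    rw [Finset.sum_eq_single u, Finset.sum_eq_single v]
    · intro z hz hne
      simp only [hF]
      rw [if_neg]
      exact fun h => hne (hC u hu z (by simpa [hI] using hz) h).2
    · simp [hI, hv]
    · intro w hw hne
      refine Finset.sum_eq_zero fun z hz => ?_
      simp only [hF]
      rw [if_neg]
      exact fun h => hne (hC w (by simpa [hI] using hw) z (by simpa [hI] using hz) h).1
    · simp [hI, hu]
  have htot : ∑ w ∈ I, ∑ z, F w z = 0 := Finset.sum_eq_zero fun w _ => hrow w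
  simp_rw [← Finset.sum_add_sum_compl I, Finset.sum_add_distrib, hin, hout, zero_add] at htot
  simp only [hF, if_pos huv] at htot
  linarith

/-- The support of a forest is an independent set. -/
theorem isIndep_supportSet [Fintype V] {G : SimpleGraph V} (hG : G.IsAcyclic) :
    IsIndep G (supportSet G) := by
  rintro u ⟨x, hx, hxu⟩ v ⟨y, hy, hyv⟩ huv
  have hbridge := SimpleGraph.isAcyclic_iff_forall_adj_isBridge.1 hG huv
  rw [SimpleGraph.isBridge_iff] at hbridge
  set C : Set V := {w | (G.deleteEdges {s(u, v)}).Reachable u w} with hCdef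
  have hu : u ∈ C := SimpleGraph.Reachable.refl u
  have hC : ∀ w ∈ C, ∀ z ∉ C, G.Adj w z → w = u ∧ z = v := by
    intro w hw z hz hwz
    by_cases h : s(w, z) = s(u, v)
    · rcases Sym2.eq_iff.1 h with h | ⟨-, rfl⟩
      · exact h
      · exact absurd hu hz
    · refine absurd (SimpleGraph.Reachable.trans hw (SimpleGraph.Adj.reachable ?_)) hz
      rw [SimpleGraph.deleteEdges_adj]
      exact ⟨hwz, h⟩
  have hcol := hG.coloringTwo.valid huv
  have key := nullSpace_mul_eq_mul_of_isolated_edge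
    (indicator_color_mem_nullSpace hG.coloringTwo hx (hG.coloringTwo u)) hy huv hu hbridge hC
  simp only [if_pos, if_neg hcol.symm, mul_zero] at key
  exact mul_ne_zero hxu hyv key

/-- A neighbour of the support has at least two neighbours in the support. -/
theorem exists_ne_adj_mem_supportSet [Fintype V] {G : SimpleGraph V} {c : V}
    (hc : c ∈ nbhdSet G (supportSet G)) (p : V) : ∃ s ∈ supportSet G, G.Adj c s ∧ s ≠ p := by
  obtain ⟨s, ⟨x, hx, hxs⟩, hsc⟩ := hc
  by_contra! h
  have hzero : ∀ t, G.Adj c t → t ≠ p → x t = 0 := fun t ht htp => by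
    by_contra hxt
    exact htp (h t ⟨x, hx, hxt⟩ ht)
  have hsp : s = p := h s ⟨x, hx, hxs⟩ hsc.symm
  have hsum := mem_nullSpace_iff.1 hx c
  rw [Finset.sum_eq_single s, if_pos hsc.symm] at hsum
  · exact hxs hsum
  · intro t _ hts
    split_ifs with ht
    · exact hzero t ht (hsp ▸ hts)
    · rfl
  · simp

/-- The edges of a tree can be oriented so that every vertex has at most one out-neighbour. -/
theorem exists_parent {G : SimpleGraph V} (hG : G.IsTree) :
    ∃ p : V → V, ∀ u v, G.Adj u v → p u = v ∨ p v = u := by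
  obtain ⟨r⟩ := hG.connected.nonempty
  choose q hq using fun v => hG.connected.exists_isPath v r
  refine ⟨fun v => (q v).snd, fun u v huv => ?_⟩
  by_cases hv : v ∈ (q u).support
  · exact .inl (hG.isAcyclic.eq_snd_of_adj_start (hq u) huv hv).symm
  · right
    have h := (hG.existsUnique_path v r).unique (hq v) ((hq u).cons (h := huv.symm) hv)
    simp [h]

/-- In a tree, the neighbourhood of the support can be matched into the support. -/
theorem exists_injOn_nbhdSet_supportSet [Fintype V] {G : SimpleGraph V} (hG : G.IsTree) :
    ∃ f : V → V, Set.InjOn f (nbhdSet G (supportSet G)) ∧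
      ∀ c ∈ nbhdSet G (supportSet G), f c ∈ supportSet G ∧ G.Adj c (f c) := by
  obtain ⟨p, hp⟩ := exists_parent hG
  have h : ∀ c, ∃ s, c ∈ nbhdSet G (supportSet G) → s ∈ supportSet G ∧ G.Adj c s ∧ s ≠ p c :=
    fun c => by
      by_cases hc : c ∈ nbhdSet G (supportSet G)
      · obtain ⟨s, hs⟩ := exists_ne_adj_mem_supportSet hc (p c)
        exact ⟨s, fun _ => hs⟩
      · exact ⟨c, fun h => absurd h hc⟩
  choose f hf using h
  have hpf : ∀ c ∈ nbhdSet G (supportSet G), p (f c) = c := fun c hc =>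
    (hp c (f c) (hf c hc).2.1).resolve_left (hf c hc).2.2.symm
  refine ⟨f, fun c hc d hd hcd => ?_, fun c hc => ⟨(hf c hc).1, (hf c hc).2.1⟩⟩
  rw [← hpf c hc, hcd, hpf d hd]

/-- If `S` is independent and its neighbourhood can be matched into `S`, then some maximum
matching has no edge with exactly one endpoint in the closed neighbourhood of `S`. -/
theorem exists_isMaxMatching_of_injOn [Fintype V] {G : SimpleGraph V} {S : Set V}
    (hS : IsIndep G S) {f : V → V} (hinj : Set.InjOn f (nbhdSet G S))
    (hf : ∀ c ∈ nbhdSet G S, f c ∈ S ∧ G.Adj c (f c)) :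
    ∃ M : Finset (Sym2 V), IsMaxMatching G M ∧
      ∀ e ∈ M, ∀ u w : V, e = s(u, w) → (u ∈ closedNbhd G S ↔ w ∈ closedNbhd G S) := by
  have hNS : ∀ c ∈ nbhdSet G S, c ∉ S := fun c ⟨s, hs, hsc⟩ hc => hS s hs c hc hsc
  set K : Finset V := Finset.univ.filter (· ∈ nbhdSet G S) with hK
  have memK : ∀ c, c ∈ K ↔ c ∈ nbhdSet G S := by simp [hK]
  set outer : Finset (Finset (Sym2 V)) := Finset.univ.filter fun M =>
    IsMatchingSet G M ∧ ∀ e ∈ M, ∀ v ∈ e, v ∉ closedNbhd G S with houter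
  obtain ⟨M₂, hM₂, hmax⟩ := outer.exists_max_image Finset.card
    ⟨∅, Finset.mem_filter.2 ⟨Finset.mem_univ _, by simp [IsMatchingSet]⟩⟩
  simp only [houter, Finset.mem_filter, Finset.mem_univ, true_and] at hM₂ hmax
  obtain ⟨⟨hM₂G, hM₂d⟩, hM₂o⟩ := hM₂
  set M₁ : Finset (Sym2 V) := K.image fun c => s(c, f c) with hM₁
  have memM₁ : ∀ e, e ∈ M₁ ↔ ∃ c ∈ nbhdSet G S, s(c, f c) = e := by simp [hM₁, memK]
  have hM₁i : ∀ e ∈ M₁, ∀ v ∈ e, v ∈ closedNbhd G S := by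
    intro e he v hv
    obtain ⟨c, hc, rfl⟩ := (memM₁ e).1 he
    rcases Sym2.mem_iff.1 hv with rfl | rfl
    · exact .inr hc
    · exact .inl (hf c hc).1
  have hM₁d : ∀ c ∈ nbhdSet G S, ∀ d ∈ nbhdSet G S, ∀ v, v ∈ s(c, f c) → v ∈ s(d, f d) →
      c = d := by
    intro c hc d hd v hvc hvd
    rcases Sym2.mem_iff.1 hvc with h | h <;> rcases Sym2.mem_iff.1 hvd with h' | h'
    · exact h.symm.trans h'
    · exact absurd ((h.symm.trans h') ▸ (hf d hd).1) (hNS c hc)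
    · exact absurd ((h'.symm.trans h) ▸ (hf c hc).1) (hNS d hd)
    · exact hinj hc hd (h.symm.trans h')
  have hM₁c : M₁.card = K.card := by
    refine Finset.card_image_of_injOn fun c hc d hd hcd => ?_
    refine hM₁d c ((memK c).1 hc) d ((memK d).1 hd) c (Sym2.mem_mk_left _ _) ?_
    exact (show s(c, f c) = s(d, f d) from hcd) ▸ Sym2.mem_mk_left c (f c)
  have hdisj : Disjoint M₁ M₂ := by
    rw [Finset.disjoint_left]
    intro e h₁ h₂
    induction e with
    | _ a b =>
      exact hM₂o _ h₂ a (Sym2.mem_mk_left a b) (hM₁i _ h₁ a (Sym2.mem_mk_left a b))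
  refine ⟨M₁ ∪ M₂, ⟨⟨?_, ?_⟩, ?_⟩, ?_⟩
  · intro e he
    rcases Finset.mem_union.1 he with he | he
    · obtain ⟨c, hc, rfl⟩ := (memM₁ e).1 he
      exact (hf c hc).2
    · exact hM₂G he
  · intro e he g hg hne v hve hvg
    rcases Finset.mem_union.1 he with he | he <;> rcases Finset.mem_union.1 hg with hg | hg
    · obtain ⟨c, hc, rfl⟩ := (memM₁ e).1 he
      obtain ⟨d, hd, rfl⟩ := (memM₁ g).1 hg
      exact hne (by rw [hM₁d c hc d hd v hve hvg])
    · exact hM₂o g hg v hvg (hM₁i e he v hve)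
    · exact hM₂o e he v hve (hM₁i g hg v hvg)
    · exact hM₂d e he g hg hne v hve hvg
  · rintro M' ⟨hM'G, hM'd⟩
    rw [Finset.card_union_of_disjoint hdisj, hM₁c,
      ← Finset.card_filter_add_card_filter_not (fun e => ∃ c ∈ nbhdSet G S, c ∈ e)]
    refine add_le_add ?_ (hmax _ ⟨⟨?_, ?_⟩, ?_⟩)
    · have hsel : ∀ e : Sym2 V, ∃ c, (∃ c ∈ nbhdSet G S, c ∈ e) → c ∈ nbhdSet G S ∧ c ∈ e :=
        fun e => by
          by_cases h : ∃ c ∈ nbhdSet G S, c ∈ e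
          · obtain ⟨c, hc⟩ := h
            exact ⟨c, fun _ => hc⟩
          · exact ⟨e.out.1, fun h' => absurd h' h⟩
      choose g hg using hsel
      refine Finset.card_le_card_of_injOn g (fun e he => ?_) fun e he e' he' hee => ?_
      · exact (memK _).2 (hg e (Finset.mem_filter.1 he).2).1
      · obtain ⟨heM, he⟩ := Finset.mem_filter.1 he
        obtain ⟨heM', he'⟩ := Finset.mem_filter.1 he'
        by_contra hne
        exact hM'd e heM e' heM' hne (g e) (hg e he).2 (hee ▸ (hg e' he').2)
    · exact fun e he => hM'G (Finset.mem_filter.1 he).1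
    · exact fun e he e' he' =>
        hM'd e (Finset.mem_filter.1 he).1 e' (Finset.mem_filter.1 he').1
    · intro e he v hv hvS
      obtain ⟨heM, he⟩ := Finset.mem_filter.1 he
      rcases hvS with hvS | hvS
      · obtain ⟨w, rfl⟩ := Sym2.mem_iff_exists.1 hv
        exact he ⟨w, ⟨v, hvS, hM'G heM⟩, Sym2.mem_mk_right v w⟩
      · exact he ⟨v, hvS, hv⟩
  · rintro e he u w rfl
    rcases Finset.mem_union.1 he with he | he
    · exact iff_of_true (hM₁i _ he u (Sym2.mem_mk_left u w)) (hM₁i _ he w (Sym2.mem_mk_right u w))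
    · exact iff_of_false (hM₂o _ he u (Sym2.mem_mk_left u w))
        (hM₂o _ he w (Sym2.mem_mk_right u w))

/-- Every tree has a maximum matching containing no connection edge, i.e. no edge
with exactly one endpoint in `N[Supp(T)]`. -/
theorem stmt16 [Fintype V] (T : SimpleGraph V) (hT : T.IsTree) :
    ∃ M : Finset (Sym2 V), IsMaxMatching T M ∧
      ∀ e ∈ M, ∀ u w : V, e = s(u, w) →
        (u ∈ closedNbhd T (supportSet T) ↔ w ∈ closedNbhd T (supportSet T)) := by
  obtain ⟨f, hinj, hf⟩ := exists_injOn_nbhdSet_supportSet hT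
  exact exists_isMaxMatching_of_injOn (isIndep_supportSet hT.isAcyclic) hinj hf

end NullDecomp
end

section
/- Let T be a tree and let N be a connected component of the subgraph of T induced by the vertex set V(T) \ N[Supp(T)], regarded as a tree in its own right. Then N is a nonsingular tree (N-tree): its adjacency matrix is invertible, equivalently N has а perfect matching. -/
open scoped Classical

namespace NullDecomp

variable {V : Type*}

/-- In an acyclic graph, a neighbour of `v` that is joined to the neighbour `s` of `v` by a walk
avoiding `v` is `s` itself. -/
theorem eq_of_adj_of_walk_avoiding {T : SimpleGraph V} (hT : T.IsAcyclic) {v s w : V}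
    (hs : T.Adj v s) (hw : T.Adj v w) (p : T.Walk s w) (hp : v ∉ p.support) : w = s := by
  have hq : v ∉ p.bypass.support := fun h => hp (p.support_bypass_subset_support h)
  have hpath : (SimpleGraph.Walk.cons hs p.bypass).IsPath :=
    p.bypass_isPath.cons hq
  have hedge : (SimpleGraph.Walk.cons hw .nil).IsPath := by
    simp [hw.ne]
  have heq := congrArg (fun r : T.Path v w => r.1.length)
    ((hT.subsingleton_path v w).elim ⟨_, hpath⟩ ⟨_, hedge⟩)
  have hlen : p.bypass.length = 0 := by simpa using heq
  exact (SimpleGraph.Walk.eq_of_length_eq_zero hlen).symm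

/-- In an acyclic graph, the indicator of a vertex outside the support but adjacent to it is the
image under the adjacency matrix of a vector vanishing outside the support. -/
theorem exists_mulVec_eq_single [Fintype V] {T : SimpleGraph V} (hT : T.IsAcyclic) {v : V}
    (hv : v ∈ nbhdSet T (supportSet T)) (hvS : v ∉ supportSet T) :
    ∃ u : V → ℝ, (∀ w ∉ supportSet T, u w = 0) ∧
      Matrix.mulVec (T.adjMatrix ℝ) u = Pi.single v 1 := by
  obtain ⟨s, ⟨x, hx, hxs⟩, hsv⟩ := hv
  have hzero : ∀ w ∉ supportSet T, x w = 0 := fun w hw => by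
    by_contra h
    exact hw ⟨x, hx, h⟩
  let K : Set V := {w | ∃ p : T.Walk s w, v ∉ p.support}
  have hsK : s ∈ K := ⟨.nil, by simpa using hsv.ne'⟩
  have hK : ∀ {a b}, a ∈ K → T.Adj a b → b ≠ v → b ∈ K := by
    rintro a b ⟨p, hp⟩ hab hb
    exact ⟨p.concat hab, by simp [SimpleGraph.Walk.support_concat, hp, hb.symm]⟩
  have hvK : v ∉ K := fun ⟨p, hp⟩ => hp p.end_mem_support
  refine ⟨fun w => (x s)⁻¹ * K.indicator x w, fun w hw => ?_, ?_⟩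
  · by_cases h : w ∈ K <;> simp [h, hzero w hw]
  ext w
  rw [SimpleGraph.adjMatrix_mulVec_apply, ← Finset.mul_sum]
  by_cases hwv : w = v
  · subst hwv
    rw [Finset.sum_eq_single s]
    · simp [hsK, hxs]
    · intro b hb hbs
      refine Set.indicator_of_notMem (fun hbK => hbs ?_) x
      obtain ⟨p, hp⟩ := hbK
      exact eq_of_adj_of_walk_avoiding hT hsv.symm (by simpa using hb) p hp
    · intro h
      exact absurd ((T.mem_neighborFinset _ _).2 hsv.symm) h
  · rw [Pi.single_eq_of_ne hwv]
    suffices h : ∑ b ∈ T.neighborFinset w, K.indicator x b = 0 by simp [h]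
    by_cases hwK : w ∈ K
    · have hxw := congrFun hx w
      rw [SimpleGraph.adjMatrix_mulVec_apply, Pi.zero_apply] at hxw
      rw [← hxw]
      refine Finset.sum_congr rfl fun b hb => ?_
      by_cases hbv : b = v
      · subst hbv
        simp [hvK, hzero b hvS]
      · exact Set.indicator_of_mem (hK hwK (by simpa using hb) hbv) x
    · refine Finset.sum_eq_zero fun b hb => Set.indicator_of_notMem (fun hbK => hwK ?_) x
      exact hK hbK (SimpleGraph.Adj.symm (by simpa using hb)) hwv

/-- A vector vanishing on the closed neighbourhood of the support of an acyclic graph is zero as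
soon as its image under the adjacency matrix vanishes outside that neighbourhood. -/
theorem eq_zero_of_mulVec_eq_zero_off_closedNbhd [Fintype V] {T : SimpleGraph V}
    (hT : T.IsAcyclic) {y : V → ℝ} (hy : ∀ w ∈ closedNbhd T (supportSet T), y w = 0)
    (hAy : ∀ w ∉ closedNbhd T (supportSet T), Matrix.mulVec (T.adjMatrix ℝ) y w = 0) : y = 0 := by
  have hS : ∀ w ∈ supportSet T, Matrix.mulVec (T.adjMatrix ℝ) y w = 0 := fun w hw => by
    rw [SimpleGraph.adjMatrix_mulVec_apply]
    exact Finset.sum_eq_zero fun b hb => hy b (.inr ⟨w, hw, by simpa using hb⟩)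
  have hsingle : ∀ v, ∃ u : V → ℝ, (∀ w ∉ supportSet T, u w = 0) ∧
      Matrix.mulVec (T.adjMatrix ℝ) u =
        Pi.single v (Matrix.mulVec (T.adjMatrix ℝ) y v) := fun v => by
    by_cases hv : v ∈ nbhdSet T (supportSet T) ∧ v ∉ supportSet T
    · obtain ⟨u, hu, hAu⟩ := exists_mulVec_eq_single hT hv.1 hv.2
      refine ⟨Matrix.mulVec (T.adjMatrix ℝ) y v • u, fun w hw => by simp [hu w hw], ?_⟩
      rw [Matrix.mulVec_smul, hAu, ← Pi.single_smul, smul_eq_mul, mul_one]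
    · have h0 : Matrix.mulVec (T.adjMatrix ℝ) y v = 0 := by
        by_cases hvS : v ∈ supportSet T
        · exact hS v hvS
        · exact hAy v fun h => h.elim hvS fun h => hv ⟨h, hvS⟩
      exact ⟨0, fun _ _ => rfl, by simp [h0]⟩
  choose u hu hAu using hsingle
  have hnull : y - ∑ v, u v ∈ nullSpace T := by
    change Matrix.mulVec (T.adjMatrix ℝ) (y - ∑ v, u v) = 0
    rw [Matrix.mulVec_sub, Matrix.mulVec_sum]
    simp only [hAu]
    rw [Finset.univ_sum_single, sub_self]
  ext w
  by_cases hw : w ∈ supportSet T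
  · exact hy w (.inl hw)
  · by_contra h
    refine hw ⟨_, hnull, ?_⟩
    simpa [Finset.sum_apply, hu _ w hw] using h

/-- Every connected component of the subgraph of a tree `T` induced by
`V(T) \ N[Supp(T)]` is a nonsingular tree: its adjacency matrix is invertible. -/
theorem stmt17 [Fintype V] (T : SimpleGraph V) (hT : T.IsTree)
    (C : Set V) (hC : IsNComponent T C) :
    IsUnit ((T.induce C).adjMatrix ℝ) := by
  obtain ⟨c, rfl⟩ := hC
  have hout : ∀ w ∈ Subtype.val '' c.supp, w ∉ closedNbhd T (supportSet T) := by
    rintro _ ⟨w, -, rfl⟩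
    exact w.2
  have hadj : ∀ {a b}, a ∈ Subtype.val '' c.supp → T.Adj a b →
      b ∉ closedNbhd T (supportSet T) → b ∈ Subtype.val '' c.supp := by
    rintro _ b ⟨a, ha, rfl⟩ hab hb
    exact ⟨⟨b, hb⟩, c.mem_supp_of_adj_mem_supp ha (by simpa using hab), rfl⟩
  generalize Subtype.val '' c.supp = C at hout hadj ⊢
  rw [← Matrix.mulVec_injective_iff_isUnit]
  refine (injective_iff_map_eq_zero (Matrix.mulVecLin ((T.induce C).adjMatrix ℝ))).2 fun z hz => ?_
  let y : V → ℝ := fun w => if h : w ∈ C then z ⟨w, h⟩ else 0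
  have hyz : ∀ w : C, y w = z w := fun w => dif_pos w.2
  have hy0 : y = 0 := by
    refine eq_zero_of_mulVec_eq_zero_off_closedNbhd hT.isAcyclic
      (fun w hw => dif_neg fun h => hout w h hw) fun w hw => ?_
    rw [SimpleGraph.adjMatrix_mulVec_apply]
    by_cases hwC : w ∈ C
    · have hzw := congrFun hz ⟨w, hwC⟩
      rw [Matrix.mulVecLin_apply, SimpleGraph.adjMatrix_mulVec_apply, Pi.zero_apply] at hzw
      rw [← hzw]
      symm
      refine Finset.sum_of_injOn Subtype.val Subtype.val_injective.injOn ?_ ?_ ?_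
      · intro b hb
        simpa using hb
      · intro b hb hbC
        refine dif_neg fun h => hbC ⟨⟨b, h⟩, ?_, rfl⟩
        simpa using hb
      · exact fun b _ => (hyz b).symm
    · refine Finset.sum_eq_zero fun b hb => dif_neg fun hbC => hwC ?_
      exact hadj hbC (SimpleGraph.Adj.symm (by simpa using hb)) hw
  ext w
  rw [← hyz w, hy0]
  rfl

end NullDecomp
end

section
/- Let T be a tree and let M be any maximum matching of T. Then M contains no connection edge: no edge of M has exactly one endpoint in the closed neighborhood N[Supp(T)]. -/
open scoped Classical

namespace NullDecomp

variable {V : Type*}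

/-- The vertex `l` is a leaf of `G` whose unique neighbor is `p`. -/
def IsLeafAt (G : SimpleGraph V) (l p : V) : Prop :=
  ∀ v, G.Adj l v ↔ v = p

theorem IsLeafAt.adj {G : SimpleGraph V} {l p : V} (h : IsLeafAt G l p) : G.Adj l p :=
  (h p).2 rfl

theorem exists_isLeafAt [Fintype V] {G : SimpleGraph V} (hG : G.IsAcyclic) {a b : V}
    (hab : G.Adj a b) : ∃ l p, IsLeafAt G l p := by
  have : Nonempty V := ⟨a⟩
  obtain ⟨u, v, p, hp, hmax⟩ := SimpleGraph.Walk.exists_isPath_forall_isPath_length_le_length G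
  have hnil : ¬ p.Nil := by
    intro h
    have h1 := hmax _ _ hab.toWalk (by simp [SimpleGraph.Walk.isPath_def, hab.ne])
    have h2 : p.length = 0 := SimpleGraph.Walk.length_eq_zero_iff.2 h
    simp [h2] at h1
  refine ⟨u, p.snd, fun w ↦ ⟨fun hadj ↦ ?_, fun h ↦ h ▸ p.adj_snd hnil⟩⟩
  apply hG.eq_snd_of_adj_start hp hadj
  have : ¬ (p.cons hadj.symm).IsPath := by grind [SimpleGraph.Walk.length_cons]
  grind [hp.cons]

section Leaf

variable {G : SimpleGraph V} {l p : V}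

theorem IsLeafAt.apply_eq_zero [Fintype V] (h : IsLeafAt G l p) {x : V → ℝ} (hx : x ∈ nullSpace G) :
    x p = 0 := by
  simpa [h _] using mem_nullSpace_iff.1 hx l

theorem IsLeafAt.notMem_supportSet [Fintype V] (h : IsLeafAt G l p) : p ∉ supportSet G :=
  fun ⟨_, hx, hxp⟩ ↦ hxp (h.apply_eq_zero hx)

theorem IsLeafAt.nullSpace_subset [Fintype V] (h : IsLeafAt G l p) :
    nullSpace G ⊆ nullSpace (G.deleteIncidenceSet p) := by
  intro x hx
  have hp := h.apply_eq_zero hx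
  rw [mem_nullSpace_iff] at hx ⊢
  intro v
  by_cases hv : v = p
  · simp [SimpleGraph.deleteIncidenceSet_adj, hv]
  · refine Eq.trans (Finset.sum_congr rfl fun u _ ↦ ?_) (hx v)
    by_cases hu : u = p
    · simp [hu, hp]
    · simp [SimpleGraph.deleteIncidenceSet_adj, hu, hv]

theorem IsLeafAt.supportSet_subset [Fintype V] (h : IsLeafAt G l p) :
    supportSet G ⊆ supportSet (G.deleteIncidenceSet p) :=
  fun _ ⟨x, hx, hv⟩ ↦ ⟨x, h.nullSpace_subset hx, hv⟩

/-- Extend a null vector of `G.deleteIncidenceSet p` to a null vector of `G`, by putting `0` at `p`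
and the value at the leaf `l` that balances the equation at `p`. -/
noncomputable def leafExtend [Fintype V] (G : SimpleGraph V) (l p : V) (x : V → ℝ) : V → ℝ :=
  fun v ↦ if v = p then 0 else if v = l then
    -∑ u, (if G.Adj p u ∧ u ≠ l then x u else 0) else x v

theorem IsLeafAt.leafExtend_mem [Fintype V] (h : IsLeafAt G l p) {x : V → ℝ}
    (hx : x ∈ nullSpace (G.deleteIncidenceSet p)) : leafExtend G l p x ∈ nullSpace G := by
  have hlp : l ≠ p := h.adj.ne
  rw [mem_nullSpace_iff] at hx ⊢
  intro v
  by_cases hv : v = p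
  · subst hv
    rw [← Finset.add_sum_erase _ _ (Finset.mem_univ l), if_pos h.adj.symm]
    have h1 : leafExtend G l v x l = -∑ u, (if G.Adj v u ∧ u ≠ l then x u else 0) := by
      simp [leafExtend, hlp]
    rw [h1, ← Finset.add_sum_erase _ _ (Finset.mem_univ l)]
    simp only [ne_eq, not_true, and_false, if_false, zero_add]
    rw [neg_add_eq_zero]
    refine Finset.sum_congr rfl fun u hu ↦ ?_
    have hul : u ≠ l := Finset.ne_of_mem_erase hu
    by_cases ha : G.Adj v u
    · simp [leafExtend, ha, hul, ha.ne']
    · simp [ha]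
  · refine Eq.trans (Finset.sum_congr rfl fun u _ ↦ ?_) (hx v)
    by_cases hu : u = p
    · simp [leafExtend, hu, SimpleGraph.deleteIncidenceSet_adj]
    · by_cases hul : u = l
      · have : ¬ G.Adj v u := fun ha ↦ hv ((h v).1 (hul ▸ ha.symm))
        simp [SimpleGraph.deleteIncidenceSet_adj, this]
      · simp [leafExtend, SimpleGraph.deleteIncidenceSet_adj, hu, hul, hv]

theorem IsLeafAt.mem_supportSet_of_ne [Fintype V] (h : IsLeafAt G l p) {v : V} (hp : v ≠ p)
    (hl : v ≠ l)
    (hv : v ∈ supportSet (G.deleteIncidenceSet p)) : v ∈ supportSet G := by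
  obtain ⟨x, hx, hxv⟩ := hv
  exact ⟨_, h.leafExtend_mem hx, by simpa [leafExtend, hp, hl] using hxv⟩

/-- Restricting a null vector to a connected component gives a null vector. -/
theorem restrict_reachable_mem_nullSpace [Fintype V] {x : V → ℝ} (hx : x ∈ nullSpace G) (q : V) :
    (fun v ↦ if G.Reachable q v then x v else 0) ∈ nullSpace G := by
  rw [mem_nullSpace_iff] at hx ⊢
  intro v
  by_cases hv : G.Reachable q v
  · refine Eq.trans (Finset.sum_congr rfl fun u _ ↦ ?_) (hx v)
    by_cases ha : G.Adj v u
    · simp [ha, hv.trans ha.reachable]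
    · simp [ha]
  · refine Finset.sum_eq_zero fun u _ ↦ ?_
    by_cases ha : G.Adj v u
    · have : ¬ G.Reachable q u := fun h ↦ hv (h.trans ha.symm.reachable)
      simp [this]
    · simp [ha]

theorem eq_of_adj_of_reachable_deleteIncidenceSet (hG : G.IsAcyclic) {q r : V}
    (hq : G.Adj p q) (hr : G.Adj p r) (hqr : (G.deleteIncidenceSet p).Reachable q r) :
    r = q := by
  by_contra hne
  have hb := SimpleGraph.isAcyclic_iff_forall_adj_isBridge.1 hG hq
  rw [SimpleGraph.isBridge_iff] at hb
  refine hb ?_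
  have hle : G.deleteIncidenceSet p ≤ G.deleteEdges {s(p, q)} := by
    intro a b hab
    rw [SimpleGraph.deleteIncidenceSet_adj] at hab
    simp only [SimpleGraph.deleteEdges_adj, Set.mem_singleton_iff, Sym2.eq_iff]
    exact ⟨hab.1, by tauto⟩
  have hpr : (G.deleteEdges {s(p, q)}).Adj p r := by
    simp only [SimpleGraph.deleteEdges_adj, Set.mem_singleton_iff, Sym2.eq_iff]
    exact ⟨hr, by rintro (⟨-, h⟩ | ⟨-, h⟩); exacts [hne h, hr.ne' h]⟩
  exact hpr.reachable.trans (hqr.mono hle).symm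

theorem IsLeafAt.leaf_mem_supportSet [Fintype V] (h : IsLeafAt G l p) (hG : G.IsAcyclic) {q : V}
    (hq : G.Adj p q) (hql : q ≠ l) (hqS : q ∈ supportSet (G.deleteIncidenceSet p)) :
    l ∈ supportSet G := by
  obtain ⟨x, hx, hxq⟩ := hqS
  refine ⟨_, h.leafExtend_mem (restrict_reachable_mem_nullSpace hx q), ?_⟩
  rw [leafExtend, if_neg h.adj.ne, if_pos rfl, neg_ne_zero]
  refine ne_of_eq_of_ne
    (Finset.sum_eq_single_of_mem q (Finset.mem_univ q) fun u _ hu ↦ ?_) ?_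
  · have : G.Adj p u → ¬ (G.deleteIncidenceSet p).Reachable q u := fun ha hr ↦
      hu (eq_of_adj_of_reachable_deleteIncidenceSet hG hq ha hr)
    simp +contextual [this]
  · simpa [hq, hql] using hxq

theorem IsMatchingSet.insert {N : Finset (Sym2 V)} (hN : IsMatchingSet G N) {a b : V}
    (hab : G.Adj a b) (hNa : ∀ e ∈ N, a ∉ e) (hNb : ∀ e ∈ N, b ∉ e) :
    IsMatchingSet G (insert s(a, b) N) := by
  refine ⟨?_, ?_⟩
  · intro e he
    rcases Finset.mem_insert.1 he with rfl | he
    exacts [hab, hN.1 he]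
  · intro e he f hf hef v hve hvf
    rcases Finset.mem_insert.1 he with rfl | he' <;>
    rcases Finset.mem_insert.1 hf with rfl | hf'
    · exact hef rfl
    · rcases Sym2.mem_iff.1 hve with rfl | rfl
      exacts [hNa f hf' hvf, hNb f hf' hvf]
    · rcases Sym2.mem_iff.1 hvf with rfl | rfl
      exacts [hNa e he' hve, hNb e he' hve]
    · exact hN.2 e he' f hf' hef v hve hvf

/-- An edge can only be added to a maximum matching if one of its endpoints is covered. -/
theorem IsMaxMatching.exists_mem_of_adj [Fintype V] {M : Finset (Sym2 V)}
    (hM : IsMaxMatching G M) {a b : V}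
    (hab : G.Adj a b) : ∃ e ∈ M, a ∈ e ∨ b ∈ e := by
  by_contra! hc
  have hcard := hM.2 _ (hM.1.insert hab (fun e he ↦ (hc e he).1) fun e he ↦ (hc e he).2)
  rw [Finset.card_insert_of_notMem fun hm ↦ (hc _ hm).1 (Sym2.mem_mk_left a b)] at hcard
  lia

theorem IsLeafAt.mem_of_mem_edge (h : IsLeafAt G l p) {e : Sym2 V} (he : e ∈ G.edgeSet)
    (hl : l ∈ e) : p ∈ e := by
  obtain ⟨w, rfl⟩ := Sym2.mem_iff_exists.1 hl
  rw [(h w).1 he]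
  exact Sym2.mem_mk_right _ _

theorem IsLeafAt.exists_mem [Fintype V] (h : IsLeafAt G l p) {M : Finset (Sym2 V)}
    (hM : IsMaxMatching G M) :
    ∃ q, s(p, q) ∈ M ∧ G.Adj p q := by
  obtain ⟨e, he, h1⟩ := hM.exists_mem_of_adj h.adj
  have hpe : p ∈ e := h1.elim (h.mem_of_mem_edge (hM.1.1 he)) id
  obtain ⟨q, rfl⟩ := Sym2.mem_iff_exists.1 hpe
  exact ⟨q, he, hM.1.1 he⟩

theorem IsMatchingSet.eq_of_mem {M : Finset (Sym2 V)} (hM : IsMatchingSet G M) {e f : Sym2 V}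
    (he : e ∈ M) (hf : f ∈ M) {v : V} (hve : v ∈ e) (hvf : v ∈ f) : e = f := by
  by_contra hne
  exact hM.2 e he f hf hne v hve hvf

theorem IsLeafAt.isMaxMatching_filter [Fintype V] (h : IsLeafAt G l p) {M : Finset (Sym2 V)}
    (hM : IsMaxMatching G M) :
    IsMaxMatching (G.deleteIncidenceSet p) (M.filter (p ∉ ·)) := by
  refine ⟨⟨?_, ?_⟩, ?_⟩
  · intro e he
    obtain ⟨he, hp⟩ := Finset.mem_filter.1 he
    have := hM.1.1 he
    induction e with | _ a b
    rw [SimpleGraph.mem_edgeSet, SimpleGraph.deleteIncidenceSet_adj]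
    simp only [Sym2.mem_iff, not_or] at hp
    exact ⟨this, Ne.symm hp.1, Ne.symm hp.2⟩
  · intro e he f hf
    exact hM.1.2 e (Finset.mem_filter.1 he).1 f (Finset.mem_filter.1 hf).1
  · intro N hN
    have hNG : IsMatchingSet G N :=
      ⟨hN.1.trans (SimpleGraph.edgeSet_mono (G.deleteIncidenceSet_le p)), hN.2⟩
    have hNp : ∀ e ∈ N, p ∉ e := by
      intro e he hp
      obtain ⟨w, rfl⟩ := Sym2.mem_iff_exists.1 hp
      have := hN.1 he
      simp [SimpleGraph.deleteIncidenceSet_adj] at this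
    have hNl : ∀ e ∈ N, l ∉ e := fun e he hl ↦ hNp e he (h.mem_of_mem_edge (hNG.1 he) hl)
    have hcard := hM.2 _ (hNG.insert h.adj hNl hNp)
    rw [Finset.card_insert_of_notMem fun hm ↦ hNl _ hm (Sym2.mem_mk_left l p)] at hcard
    have hsum := M.card_filter_add_card_filter_not (p ∈ ·)
    have hone : (M.filter (p ∈ ·)).card ≤ 1 := by
      refine Finset.card_le_one.2 fun e he f hf ↦ ?_
      rw [Finset.mem_filter] at he hf
      exact hM.1.eq_of_mem he.1 hf.1 he.2 hf.2
    lia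

/-- Away from the leaf `l` and its neighbor `p`, the closed neighborhoods of the supports of `G`
and of `G.deleteIncidenceSet p` agree. -/
theorem IsLeafAt.mem_closedNbhd_iff [Fintype V] (h : IsLeafAt G l p) {v : V} (hp : v ≠ p)
    (hl : v ≠ l) :
    v ∈ closedNbhd G (supportSet G) ↔
      v ∈ closedNbhd (G.deleteIncidenceSet p) (supportSet (G.deleteIncidenceSet p)) := by
  constructor
  · rintro (hv | ⟨s, hs, hsv⟩)
    · exact .inl (h.supportSet_subset hv)
    · refine .inr ⟨s, h.supportSet_subset hs, ?_⟩
      rw [SimpleGraph.deleteIncidenceSet_adj]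
      exact ⟨hsv, fun e ↦ h.notMem_supportSet (e ▸ hs), hp⟩
  · rintro (hv | ⟨s, hs, hsv⟩)
    · exact .inl (h.mem_supportSet_of_ne hp hl hv)
    · rw [SimpleGraph.deleteIncidenceSet_adj] at hsv
      refine .inr ⟨s, h.mem_supportSet_of_ne hsv.2.1 ?_ hs, hsv.1⟩
      rintro rfl
      exact hp ((h v).1 hsv.1)

theorem IsLeafAt.mem_closedNbhd_iff_leaf [Fintype V] (h : IsLeafAt G l p) (hG : G.IsAcyclic) :
    p ∈ closedNbhd G (supportSet G) ↔ l ∈ closedNbhd G (supportSet G) := by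
  constructor
  · rintro (hp | ⟨s, hs, hsp⟩)
    · exact absurd hp h.notMem_supportSet
    · by_cases hsl : s = l
      · exact .inl (hsl ▸ hs)
      · exact .inl (h.leaf_mem_supportSet hG hsp.symm hsl (h.supportSet_subset hs))
  · rintro (hl | ⟨s, hs, hsl⟩)
    · exact .inr ⟨l, hl, h.adj⟩
    · rw [(h s).1 hsl.symm] at hs
      exact absurd hs h.notMem_supportSet

end Leaf

theorem mem_supportSet_of_forall_not_adj [Fintype V] {G : SimpleGraph V}
    (hG : ∀ a b, ¬ G.Adj a b) (v : V) : v ∈ supportSet G :=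
  ⟨fun _ ↦ 1, mem_nullSpace_iff.2 fun a ↦ by simp [hG], one_ne_zero⟩

/-- In a forest, the vertices missed by a maximum matching lie in the support, and no edge of the
matching leaves the closed neighborhood of the support. -/
theorem IsMaxMatching.supportSet_of_isAcyclic [Fintype V] (G : SimpleGraph V)
    (hG : G.IsAcyclic) (M : Finset (Sym2 V)) (hM : IsMaxMatching G M) :
    (∀ v, (∀ e ∈ M, v ∉ e) → v ∈ supportSet G) ∧
      ∀ u w, s(u, w) ∈ M →
        (u ∈ closedNbhd G (supportSet G) ↔ w ∈ closedNbhd G (supportSet G)) := by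
  induction G using WellFoundedLT.induction generalizing M with
  | ind G ih =>
  by_cases hE : ∀ a b, ¬ G.Adj a b
  · exact ⟨fun v _ ↦ mem_supportSet_of_forall_not_adj hE v,
      fun u w huw ↦ absurd (hM.1.1 huw) (hE u w)⟩
  push Not at hE
  obtain ⟨a, b, hab⟩ := hE
  obtain ⟨l, p, h⟩ := exists_isLeafAt hG hab
  have hlt : G.deleteIncidenceSet p < G := by
    refine lt_of_le_of_ne (G.deleteIncidenceSet_le p) fun he ↦ ?_
    have := h.adj
    rw [← he, SimpleGraph.deleteIncidenceSet_adj] at this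
    exact this.2.2 rfl
  obtain ⟨ih1, ih2⟩ := ih _ hlt (hG.anti hlt.le) _ (h.isMaxMatching_filter hM)
  obtain ⟨q, hpq, hadj⟩ := h.exists_mem hM
  have hqS : q ∈ supportSet (G.deleteIncidenceSet p) := by
    refine ih1 q fun e he hqe ↦ ?_
    rw [Finset.mem_filter] at he
    apply he.2
    rw [hM.1.eq_of_mem he.1 hpq hqe (Sym2.mem_mk_right p q)]
    exact Sym2.mem_mk_left p q
  have hiff : p ∈ closedNbhd G (supportSet G) ↔ q ∈ closedNbhd G (supportSet G) := by
    by_cases hql : q = l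
    · exact hql ▸ h.mem_closedNbhd_iff_leaf hG
    · have hq := h.mem_supportSet_of_ne hadj.ne' hql hqS
      exact iff_of_true (.inr ⟨q, hq, hadj.symm⟩) (.inl hq)
  refine ⟨fun v hv ↦ ?_, fun u w huw ↦ ?_⟩
  · by_cases hvl : v = l
    · subst hvl
      refine h.leaf_mem_supportSet hG hadj ?_ hqS
      rintro rfl
      exact hv _ hpq (Sym2.mem_mk_right p q)
    · refine h.mem_supportSet_of_ne ?_ hvl
        (ih1 v fun e he ↦ hv e (Finset.mem_filter.1 he).1)
      rintro rfl
      exact hv _ hpq (Sym2.mem_mk_left v q)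
  · by_cases hpe : p ∈ s(u, w)
    · have := hM.1.eq_of_mem hpq huw (Sym2.mem_mk_left p q) hpe
      rcases Sym2.eq_iff.1 this with ⟨rfl, rfl⟩ | ⟨rfl, rfl⟩
      exacts [hiff, hiff.symm]
    · have hle : l ∉ s(u, w) := fun hl ↦ hpe (h.mem_of_mem_edge (hM.1.1 huw) hl)
      have := ih2 u w (Finset.mem_filter.2 ⟨huw, hpe⟩)
      simp only [Sym2.mem_iff, not_or] at hpe hle
      rwa [h.mem_closedNbhd_iff (Ne.symm hpe.1) (Ne.symm hle.1),
        h.mem_closedNbhd_iff (Ne.symm hpe.2) (Ne.symm hle.2)]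

/-- No maximum matching of a tree contains a connection edge: no edge of a maximum
matching has exactly one endpoint in `N[Supp(T)]`. -/
theorem stmt18 [Fintype V] (T : SimpleGraph V) (hT : T.IsTree)
    (M : Finset (Sym2 V)) (hM : IsMaxMatching T M) :
    ∀ e ∈ M, ∀ u w : V, e = s(u, w) →
      (u ∈ closedNbhd T (supportSet T) ↔ w ∈ closedNbhd T (supportSet T)) := by
  rintro e he u w rfl
  exact (IsMaxMatching.supportSet_of_isAcyclic T hT.isAcyclic M hM).2 u w he

end NullDecomp
end

section
/- Let T be a tree. Then the matching number and independence number of T are given by ν(T) = |Core(T)| + |V(T) \ N[Supp(T)]| / 2 and α(T) = |Supp(T)| + |V(T) \ N[Supp(T)]| / 2, where Core(T) := N(Supp(T)). Moreover, the number of maximum matchings of T equals the product, over all connected components S of the subgraph of T induced by N[Supp(T)], of the number of maximum matchings of S. -/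
open scoped Classical

namespace NullDecomp

variable {V : Type*}

/-- A height function in which neighbors differ by one level and every vertex has at most one
neighbor on the level below it, as given by the distance to the root of a rooted tree. -/
structure IsDepth (G : SimpleGraph V) (d : V → ℕ) : Prop where
  adj : ∀ {u v}, G.Adj u v → d u = d v + 1 ∨ d v = d u + 1
  parent : ∀ {v a b}, G.Adj v a → G.Adj v b → d a < d v → d b < d v → a = b

lemma IsDepth.even_iff {G : SimpleGraph V} {d : V → ℕ} (hd : IsDepth G d) {u v : V}
    (h : G.Adj u v) : Even (d u) ↔ ¬ Even (d v) := by
  rcases hd.adj h with h | h <;> rw [h, Nat.even_add_one]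
  tauto

lemma exists_isDepth {T : SimpleGraph V} (hT : T.IsTree) : ∃ d : V → ℕ, IsDepth T d := by
  obtain ⟨r⟩ := hT.connected.nonempty
  refine ⟨T.dist r, fun h => hT.dist_eq_dist_add_one_of_adj r h, ?_⟩
  intro v a b ha hb hda hdb
  obtain ⟨p, hp, hpl⟩ := hT.connected.exists_path_of_dist r v
  have key : ∀ c, T.Adj v c → T.dist r c < T.dist r v → c = p.penultimate := by
    intro c hc hlt
    obtain ⟨q, hq, hql⟩ := hT.connected.exists_path_of_dist r c
    refine hT.isAcyclic.eq_penultimate_of_adj_end hp hc ?_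
    refine hT.isAcyclic.mem_support_of_ne_mem_support_of_adj_of_isPath hp hq hc ?_
    intro hv
    have h1 := T.dist_le (q.takeUntil v hv)
    have h2 := q.length_takeUntil_le_length hv
    omega
  rw [key a ha hda, key b hb hdb]

section NullSpace

variable [Fintype V] {T : SimpleGraph V}

lemma mem_nullSpace {x : V → ℝ} :
    x ∈ nullSpace T ↔ ∀ v, ∑ u, (if T.Adj v u then x u else 0) = 0 := by
  simp only [nullSpace, Set.mem_ofPred_eq, funext_iff, Matrix.mulVec, dotProduct,
    SimpleGraph.adjMatrix_apply, ite_mul, one_mul, zero_mul, Pi.zero_apply]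

/-- Changing the sign of a null vector on one color class gives a null vector. -/
lemma IsDepth.neg_one_pow_mul_mem_nullSpace {d : V → ℕ} (hd : IsDepth T d) {x : V → ℝ}
    (hx : x ∈ nullSpace T) : (fun v => (-1) ^ d v * x v) ∈ nullSpace T := by
  rw [mem_nullSpace] at hx ⊢
  intro v
  have h : ∀ u, (if T.Adj v u then (-1) ^ d u * x u else 0)
      = -(-1) ^ d v * (if T.Adj v u then x u else 0) := by
    intro u
    split_ifs with h
    · rcases hd.adj h with h | h <;> rw [h, pow_succ] <;> ring
    · simp
  simp_rw [h, ← Finset.mul_sum, hx v, mul_zero]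

/-- Across an edge of a forest, two null vectors are proportional. -/
lemma mul_eq_mul_of_adj (hT : T.IsAcyclic) {x y : V → ℝ} (hx : x ∈ nullSpace T)
    (hy : y ∈ nullSpace T) {u v : V} (h : T.Adj u v) : y u * x v = x u * y v := by
  have hb := SimpleGraph.isBridge_iff.1 (SimpleGraph.isAcyclic_iff_forall_adj_isBridge.1 hT h)
  set H := T.deleteEdges {s(u, v)} with hH
  let U : Finset V := Finset.univ.filter (H.Reachable u)
  have hu : u ∈ U := by simp [U]
  have hv : v ∈ Uᶜ := by simpa [U] using hb
  let g : V → V → ℝ := fun a b => if T.Adj a b then y a * x b - x a * y b else 0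
  have hcut : ∀ a ∈ U, ∀ b ∈ Uᶜ, T.Adj a b → a = u ∧ b = v := by
    intro a ha b hb' hab
    simp only [U, Finset.mem_filter, Finset.mem_univ, true_and, Finset.mem_compl] at ha hb'
    by_cases he : s(a, b) = s(u, v)
    · rcases Sym2.eq_iff.1 he with h | ⟨rfl, rfl⟩
      · exact h
      · exact absurd ha hb
    · exact absurd (ha.trans (SimpleGraph.Adj.reachable (by simp [hH, hab]; simpa using he))) hb'
  have hzero : ∀ a, ∑ b, g a b = 0 := by
    intro a
    have : ∀ b, g a b = y a * (if T.Adj a b then x b else 0)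
        - x a * (if T.Adj a b then y b else 0) := by
      intro b; simp only [g]; split_ifs <;> simp
    simp_rw [this, Finset.sum_sub_distrib, ← Finset.mul_sum, mem_nullSpace.1 hx a,
      mem_nullSpace.1 hy a]
    simp
  have hanti : ∑ a ∈ U, ∑ b ∈ U, g a b = 0 := by
    have h1 : ∑ a ∈ U, ∑ b ∈ U, g a b = -∑ a ∈ U, ∑ b ∈ U, g a b := by
      conv_lhs => rw [Finset.sum_comm]
      simp_rw [← Finset.sum_neg_distrib]
      refine Finset.sum_congr rfl fun a _ => Finset.sum_congr rfl fun b _ => ?_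
      simp only [g, T.adj_comm b a]
      split_ifs <;> ring
    linarith
  have hcross : ∑ a ∈ U, ∑ b ∈ Uᶜ, g a b = g u v := by
    rw [Finset.sum_eq_single_of_mem u hu, Finset.sum_eq_single_of_mem v hv]
    · intro b hb' hne
      exact if_neg fun hab => hne (hcut u hu b hb' hab).2
    · intro a ha hne
      exact Finset.sum_eq_zero fun b hb' => if_neg fun hab => hne (hcut a ha b hb' hab).1
  have htot : ∑ a ∈ U, (∑ b ∈ U, g a b + ∑ b ∈ Uᶜ, g a b) = 0 :=
    Finset.sum_eq_zero fun a _ => by rw [Finset.sum_add_sum_compl, hzero]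
  rw [Finset.sum_add_distrib, hanti, hcross, zero_add] at htot
  simp only [g, if_pos h] at htot
  linarith

/-- The support of a forest is independent. -/
lemma IsDepth.isIndep_supportSet {d : V → ℕ} (hd : IsDepth T d) (hT : T.IsAcyclic) :
    IsIndep T (supportSet T) := by
  rintro u ⟨x, hx, hxu⟩ v ⟨y, hy, hyv⟩ h
  have h1 := mul_eq_mul_of_adj hT hx hy h
  have h2 := mul_eq_mul_of_adj hT (hd.neg_one_pow_mul_mem_nullSpace hx) hy h
  have h3 : (-1 : ℝ) ^ d v = -(-1) ^ d u := by
    rcases hd.adj h with h | h <;> rw [h, pow_succ] <;> ring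
  have h4 : (-1 : ℝ) ^ d u ≠ 0 := pow_ne_zero _ (by norm_num)
  rw [h3] at h2
  have h5 : (-1 : ℝ) ^ d u * (x u * y v) = 0 := by
    linear_combination (-1 / 2) * h2 - (-1) ^ d u / 2 * h1
  simp_all

/-- Every core vertex has a child in the support. -/
lemma IsDepth.exists_child {d : V → ℕ} (hd : IsDepth T d) {c : V} (hc : c ∈ coreSet T) :
    ∃ s ∈ supportSet T, T.Adj c s ∧ d s = d c + 1 := by
  obtain ⟨s, ⟨x, hx, hxs⟩, hsc⟩ := hc
  have hcs := hsc.symm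
  obtain ⟨t, hct, hts, hxt⟩ : ∃ t, T.Adj c t ∧ t ≠ s ∧ x t ≠ 0 := by
    by_contra! hcon
    have h := mem_nullSpace.1 hx c
    rw [Finset.sum_eq_single_of_mem s (Finset.mem_univ s), if_pos hcs] at h
    · exact hxs h
    · intro t _ hts
      split_ifs with hct
      · exact hcon t hct hts
      · rfl
  rcases hd.adj hcs with h1 | h1
  · rcases hd.adj hct with h2 | h2
    · exact absurd (hd.parent hct hcs (by omega) (by omega)) hts
    · exact ⟨t, ⟨x, hx, hxt⟩, hct, h2⟩
  · exact ⟨s, ⟨x, hx, hxs⟩, hcs, h1⟩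

/-- The vertices outside the closed neighborhood of the support span a nonsingular subgraph. -/
lemma IsDepth.det_ne_zero {d : V → ℕ} (hd : IsDepth T d) (hT : T.IsAcyclic) :
    (Matrix.of fun a b : ↥(closedNbhd T (supportSet T))ᶜ =>
      if T.Adj a b then (1 : ℝ) else 0).det ≠ 0 := by
  choose! σ hσS hσadj hσd using fun c (hc : c ∈ coreSet T) => hd.exists_child hc
  have hindep := hd.isIndep_supportSet hT
  let Q : Matrix (coreSet T) (coreSet T) ℝ := Matrix.of fun c c' =>
    if T.Adj c (σ c') then 1 else 0
  have hQ : Q.det ≠ 0 := by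
    intro h0
    obtain ⟨w, hw, hwQ⟩ := Matrix.exists_vecMul_eq_zero_iff.2 h0
    obtain ⟨c, hc, hmax⟩ := (Finset.univ.filter fun c => w c ≠ 0).exists_max_image
      (fun c => d c) (by
        obtain ⟨c, hc⟩ := Function.ne_iff.1 hw
        exact ⟨c, by simpa using hc⟩)
    simp only [Finset.mem_filter, Finset.mem_univ, true_and] at hc hmax
    have h1 := congrFun hwQ c
    simp only [Matrix.vecMul, dotProduct, Pi.zero_apply] at h1
    rw [Finset.sum_eq_single_of_mem c (Finset.mem_univ c)] at h1
    · simp [Q, hσadj c c.2, hc] at h1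
    · intro b _ hbc
      by_cases hwb : w b = 0
      · simp [hwb]
      · have := hmax b hwb
        have hcd := hσd c c.2
        have : ¬ T.Adj b (σ c) := fun hadj => hbc <| Subtype.ext <|
          hd.parent hadj.symm (hσadj c c.2).symm (by omega) (by omega)
        simp [Q, this]
  intro h0
  obtain ⟨y, hy, hyR⟩ := Matrix.exists_mulVec_eq_zero_iff.2 h0
  obtain ⟨r, hr⟩ := Function.ne_iff.1 hy
  let b : coreSet T → ℝ := fun c =>
    -∑ r : ↥(closedNbhd T (supportSet T))ᶜ, if T.Adj c r then y r else 0
  let z := Q⁻¹.mulVec b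
  have hz : Q.mulVec z = b := by
    rw [Matrix.mulVec_mulVec, Matrix.mul_nonsing_inv _ (isUnit_iff_ne_zero.2 hQ),
      Matrix.one_mulVec]
  let x : V → ℝ := fun v => ∑ c : coreSet T, (if v = σ c then z c else 0) +
    ∑ r : ↥(closedNbhd T (supportSet T))ᶜ, if v = r then y r else 0
  have hsum : ∀ v, ∑ u, (if T.Adj v u then x u else 0) =
      ∑ c : coreSet T, (if T.Adj v (σ c) then z c else 0) +
      ∑ r : ↥(closedNbhd T (supportSet T))ᶜ, if T.Adj v r then y r else 0 := by
    intro v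
    have : ∀ u, (if T.Adj v u then x u else 0) =
        ∑ c : coreSet T, (if u = σ c then (if T.Adj v (σ c) then z c else 0) else 0) +
        ∑ r : ↥(closedNbhd T (supportSet T))ᶜ,
          if u = r then (if T.Adj v r then y r else 0) else 0 := by
      intro u
      split_ifs with huv
      · simp only [x]
        congr 1 <;> refine Finset.sum_congr rfl fun a _ => ?_ <;> split_ifs with h1 h2 <;>
          simp_all
      · symm
        rw [Finset.sum_eq_zero, Finset.sum_eq_zero, add_zero] <;> intro a _ <;>
          split_ifs with h1 h2 <;> simp_all
    simp_rw [this, Finset.sum_add_distrib]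
    congr 1 <;> rw [Finset.sum_comm] <;> simp
  have hx : x ∈ nullSpace T := by
    rw [mem_nullSpace]
    intro v
    rw [hsum]
    by_cases hvC : v ∈ coreSet T
    · have := congrFun hz ⟨v, hvC⟩
      simp only [Matrix.mulVec, dotProduct, Q, Matrix.of_apply, ite_mul, one_mul, zero_mul, b]
        at this
      rw [this, neg_add_cancel]
    · rw [Finset.sum_eq_zero, zero_add]
      · by_cases hvS : v ∈ supportSet T
        · refine Finset.sum_eq_zero fun a _ => if_neg fun hva => a.2 (Or.inr ⟨v, hvS, hva⟩)
        · have := congrFun hyR ⟨v, fun h => h.elim hvS hvC⟩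
          simpa only [Matrix.mulVec, dotProduct, Matrix.of_apply, ite_mul, one_mul, zero_mul,
            Pi.zero_apply] using this
      · intro c _
        exact if_neg fun hvc => hvC ⟨σ c, hσS c c.2, hvc.symm⟩
  refine r.2 (Or.inl ⟨x, hx, ?_⟩)
  have : x r = y r := by
    simp only [x]
    rw [Finset.sum_eq_zero, zero_add, Finset.sum_eq_single_of_mem r (Finset.mem_univ r)]
    · simp
    · intro b _ hb
      exact if_neg fun h => hb (Subtype.ext h.symm)
    · intro c _
      exact if_neg fun h : (r : V) = σ c => r.2 (Or.inl (h ▸ hσS c c.2))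
  rw [this]
  exact hr

/-- Outside the closed neighborhood of the support, there is a permutation moving each vertex
to a neighbor. -/
lemma IsDepth.exists_perm {d : V → ℕ} (hd : IsDepth T d) (hT : T.IsAcyclic) :
    ∃ τ : Equiv.Perm ↥(closedNbhd T (supportSet T))ᶜ,
      ∀ r : ↥(closedNbhd T (supportSet T))ᶜ, T.Adj r (τ r : V) := by
  have h := hd.det_ne_zero hT
  rw [Matrix.det_apply] at h
  obtain ⟨τ, -, hτ⟩ := Finset.exists_ne_zero_of_sum_ne_zero h
  refine ⟨τ, fun r => ?_⟩
  by_contra hr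
  refine hτ ?_
  have h0 : ∏ i, (Matrix.of fun a b : ↥(closedNbhd T (supportSet T))ᶜ =>
      if T.Adj a b then (1 : ℝ) else 0) (τ i) i = 0 :=
    Finset.prod_eq_zero (Finset.mem_univ r) (if_neg fun h => hr h.symm)
  exact (congrArg _ h0).trans (smul_zero (Equiv.Perm.sign τ))

end NullSpace

section Matching

variable {G : SimpleGraph V} {M : Finset (Sym2 V)}

lemma isMatchingSet_iff : IsMatchingSet G M ↔ (∀ a b, s(a, b) ∈ M → G.Adj a b) ∧
    ∀ a b c, s(a, b) ∈ M → s(a, c) ∈ M → b = c := by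
  constructor
  · rintro ⟨h1, h2⟩
    refine ⟨fun a b h => h1 h, fun a b c hb hc => ?_⟩
    by_contra hne
    refine h2 _ hb _ hc (fun h => hne ?_) a (by simp) (by simp)
    exact Sym2.congr_right.1 h
  · rintro ⟨h1, h2⟩
    constructor
    · intro e he
      induction e with
      | _ a b => exact h1 a b he
    · intro e he f hf hef v hve hvf
      obtain ⟨a, rfl⟩ := hve
      obtain ⟨b, rfl⟩ := hvf
      exact hef (by rw [h2 v a b he hf])

lemma IsMatchingSet.adj (hM : IsMatchingSet G M) {a b : V} (h : s(a, b) ∈ M) : G.Adj a b :=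
  (isMatchingSet_iff.1 hM).1 a b h

lemma IsMatchingSet.unique (hM : IsMatchingSet G M) {a b c : V} (hb : s(a, b) ∈ M)
    (hc : s(a, c) ∈ M) : b = c :=
  (isMatchingSet_iff.1 hM).2 a b c hb hc

/-- Two matchings of a forest cannot both match a set of vertices perfectly within itself unless
they agree on it. -/
lemma IsDepth.matching_unique [Fintype V] {d : V → ℕ} (hd : IsDepth G d) {R : Set V}
    {M' : Finset (Sym2 V)} (hM : IsMatchingSet G M) (hM' : IsMatchingSet G M')
    (hR : ∀ r ∈ R, ∃ r' ∈ R, s(r, r') ∈ M) (hR' : ∀ r ∈ R, ∃ r' ∈ R, s(r, r') ∈ M')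
    {a b : V} (ha : a ∈ R) (hab : s(a, b) ∈ M) : s(a, b) ∈ M' := by
  choose! m hmR hm using hR
  choose! m' hmR' hm' using hR'
  have key : ∀ r ∈ R, m r = m' r := by
    by_contra! hcon
    obtain ⟨r, hr, hmax⟩ := (Finset.univ.filter fun r => r ∈ R ∧ m r ≠ m' r).exists_max_image
      d (by obtain ⟨r, hr⟩ := hcon; exact ⟨r, by simpa using hr⟩)
    simp only [Finset.mem_filter, Finset.mem_univ, true_and] at hr hmax
    obtain ⟨hrR, hne⟩ := hr
    have h1 := hM.adj (hm r hrR)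
    have h2 := hM'.adj (hm' r hrR)
    rcases hd.adj h1 with hd1 | hd1
    · rcases hd.adj h2 with hd2 | hd2
      · exact hne (hd.parent h1 h2 (by omega) (by omega))
      · have hb : m (m' r) = m' (m' r) := by
          by_contra hb
          have := hmax _ ⟨hmR' r hrR, hb⟩
          omega
        have h3 : m' (m' r) = r :=
          hM'.unique (hm' _ (hmR' r hrR)) (Sym2.eq_swap ▸ hm' r hrR)
        have h4 := hm _ (hmR' r hrR)
        rw [hb, h3, Sym2.eq_swap] at h4
        exact hne (hM.unique (hm r hrR) h4)
    · have hb : m (m r) = m' (m r) := by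
        by_contra hb
        have := hmax _ ⟨hmR r hrR, hb⟩
        omega
      have h3 : m (m r) = r := hM.unique (hm _ (hmR r hrR)) (Sym2.eq_swap ▸ hm r hrR)
      have h4 := hm' _ (hmR r hrR)
      rw [← hb, h3, Sym2.eq_swap] at h4
      exact hne (hM'.unique h4 (hm' r hrR))
  rw [hM.unique hab (hm a ha), key a ha]
  exact hm' a ha

lemma IsMatchingSet.card_le_of_cover [Fintype V] (hM : IsMatchingSet G M) {K : Set V}
    (hK : ∀ e ∈ M, ∃ v ∈ K, v ∈ e) : M.card ≤ K.ncard := by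
  rcases isEmpty_or_nonempty V with hV | hV
  · simp [Finset.eq_empty_of_isEmpty M]
  rw [← Set.ncard_coe_finset]
  choose! f hfK hf using hK
  refine Set.ncard_le_ncard_of_injOn f hfK ?_
  intro e he e₂ he₂ hee
  by_contra hne
  exact hM.2 e he e₂ he₂ hne _ (hf e he) (hee ▸ hf e₂ he₂)

/-- Data exhibiting `K` as a vertex cover of the same size as a matching: each vertex of `K` is
matched by `σ` to a vertex outside `K`. -/
structure IsKonig (G : SimpleGraph V) (K : Set V) (σ : V → V) : Prop where
  cover : ∀ {u v}, G.Adj u v → u ∈ K ∨ v ∈ K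
  adj : ∀ v ∈ K, G.Adj v (σ v)
  notMem : ∀ v ∈ K, σ v ∉ K
  injOn : Set.InjOn σ K

variable [Fintype V] {K : Set V} {σ : V → V}

lemma IsKonig.card_le (hK : IsKonig G K σ) (hM : IsMatchingSet G M) : M.card ≤ K.ncard := by
  refine hM.card_le_of_cover fun e he => ?_
  induction e with
  | _ a b => rcases hK.cover (hM.adj he) with h | h <;> exact ⟨_, h, by simp⟩

lemma ncard_le_card_of_saturated (h : ∀ k ∈ K, ∃ w ∉ K, s(k, w) ∈ M) :
    K.ncard ≤ M.card := by
  rw [← Set.ncard_coe_finset]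
  choose! w hwK hw using h
  refine Set.ncard_le_ncard_of_injOn (fun k => s(k, w k)) hw ?_
  intro k hk k' hk' h
  rcases Sym2.eq_iff.1 h with h | h
  · exact h.1
  · exact absurd (h.1 ▸ hk) (hwK k' hk')

lemma IsKonig.exists_matching (hK : IsKonig G K σ) :
    ∃ M, IsMatchingSet G M ∧ ∀ k ∈ K, s(k, σ k) ∈ M := by
  refine ⟨K.toFinset.image fun k => s(k, σ k), isMatchingSet_iff.2 ⟨?_, ?_⟩, ?_⟩
  · intro a b h
    simp only [Finset.mem_image, Set.mem_toFinset] at h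
    obtain ⟨k, hk, h⟩ := h
    rw [← SimpleGraph.mem_edgeSet, ← h]
    exact hK.adj k hk
  · intro a b c hb hc
    simp only [Finset.mem_image, Set.mem_toFinset] at hb hc
    obtain ⟨k, hk, hb⟩ := hb
    obtain ⟨l, hl, hc⟩ := hc
    rcases Sym2.eq_iff.1 hb with ⟨rfl, rfl⟩ | ⟨rfl, rfl⟩ <;>
      rcases Sym2.eq_iff.1 hc with ⟨h1, rfl⟩ | ⟨rfl, h1⟩
    · rw [h1]
    · exact absurd (h1 ▸ hk) (hK.notMem l hl)
    · exact absurd (h1 ▸ hl) (hK.notMem k hk)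
    · exact hK.injOn hk hl h1.symm
  · intro k hk
    simp only [Finset.mem_image, Set.mem_toFinset]
    exact ⟨k, hk, rfl⟩

lemma IsKonig.isMaxMatching_iff (hK : IsKonig G K σ) :
    IsMaxMatching G M ↔ IsMatchingSet G M ∧ ∀ k ∈ K, ∃ w ∉ K, s(k, w) ∈ M := by
  constructor
  · rintro ⟨hM, hmax⟩
    refine ⟨hM, ?_⟩
    obtain ⟨N, hN, hNσ⟩ := hK.exists_matching
    have hcard : K.ncard ≤ M.card :=
      (ncard_le_card_of_saturated fun k hk => ⟨σ k, hK.notMem k hk, hNσ k hk⟩).trans (hmax N hN)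
    have hlt : ∀ k ∈ K, ¬ M.card ≤ (K \ {k}).ncard := by
      intro k hk
      have := Set.ncard_sdiff_singleton_lt_of_mem hk
      omega
    have hcov : ∀ k, ∀ e ∈ M, k ∉ e → ∃ v ∈ K \ {k}, v ∈ e := by
      intro k e he hke
      induction e with
      | _ a b =>
        simp only [Sym2.mem_iff, not_or] at hke
        rcases hK.cover (hM.adj he) with h | h
        · exact ⟨a, ⟨h, Ne.symm hke.1⟩, by simp⟩
        · exact ⟨b, ⟨h, Ne.symm hke.2⟩, by simp⟩
    have hout : ∀ k ∈ K, ∀ w, s(k, w) ∈ M → w ∉ K := by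
      intro k hk w hkw hw
      refine hlt k hk (hM.card_le_of_cover fun e he => ?_)
      by_cases hke : k ∈ e
      · obtain ⟨b, rfl⟩ := hke
        obtain rfl := hM.unique hkw he
        exact ⟨w, ⟨hw, (hM.adj hkw).ne'⟩, by simp⟩
      · exact hcov k e he hke
    intro k hk
    by_contra! hcon
    refine hlt k hk (hM.card_le_of_cover fun e he => hcov k e he ?_)
    rintro ⟨b, rfl⟩
    by_cases hb : b ∈ K
    · exact hout k hk b he hb
    · exact hcon b hb he
  · rintro ⟨hM, h⟩
    exact ⟨hM, fun N hN => (hK.card_le hN).trans (ncard_le_card_of_saturated h)⟩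

lemma IsKonig.exists_isMaxMatching (hK : IsKonig G K σ) : ∃ M, IsMaxMatching G M := by
  obtain ⟨M, hM, h⟩ := hK.exists_matching
  exact ⟨M, hK.isMaxMatching_iff.2 ⟨hM, fun k hk => ⟨σ k, hK.notMem k hk, h k hk⟩⟩⟩

lemma IsKonig.matchingNumber_eq (hK : IsKonig G K σ) : matchingNumber G = K.ncard := by
  obtain ⟨M, hM, h⟩ := hK.exists_matching
  refine IsGreatest.csSup_eq ⟨⟨M, hM, le_antisymm (hK.card_le hM) ?_⟩, ?_⟩
  · exact ncard_le_card_of_saturated fun k hk => ⟨σ k, hK.notMem k hk, h k hk⟩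
  · rintro n ⟨N, hN, rfl⟩
    exact hK.card_le hN

lemma IsKonig.indepNumber_eq (hK : IsKonig G K σ) : indepNumber G = Kᶜ.ncard := by
  refine IsGreatest.csSup_eq ⟨⟨Kᶜ, fun u hu w hw h => (hK.cover h).elim hu hw, rfl⟩, ?_⟩
  rintro n ⟨A, hA, rfl⟩
  refine Set.ncard_le_ncard_of_injOn (fun v => if v ∈ K then σ v else v) ?_ ?_
  · intro v _
    split_ifs with hv
    · exact hK.notMem v hv
    · exact hv
  · intro u hu v hv h
    change (if u ∈ K then σ u else u) = if v ∈ K then σ v else v at h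
    split_ifs at h with huK hvK hvK
    · exact hK.injOn huK hvK h
    · exact absurd (h ▸ hK.adj u huK) (hA u hu v hv)
    · exact absurd (h ▸ hK.adj v hvK) (hA v hv u hu)
    · exact h

end Matching

section Components

variable {G : SimpleGraph V} {U : Set V} {c c' : (G.induce U).ConnectedComponent} {v w : V}

lemma mem_val_image_supp :
    v ∈ Subtype.val '' c.supp ↔ ∃ h : v ∈ U, (G.induce U).connectedComponentMk ⟨v, h⟩ = c := by
  simp [SimpleGraph.ConnectedComponent.mem_supp_iff]

lemma mem_of_mem_val_image_supp (h : v ∈ Subtype.val '' c.supp) : v ∈ U :=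
  (mem_val_image_supp.1 h).1

lemma exists_mem_val_image_supp (h : v ∈ U) :
    ∃ c : (G.induce U).ConnectedComponent, v ∈ Subtype.val '' c.supp :=
  ⟨_, mem_val_image_supp.2 ⟨h, rfl⟩⟩

lemma eq_of_mem_val_image_supp (h : v ∈ Subtype.val '' c.supp)
    (h' : v ∈ Subtype.val '' c'.supp) : c = c' := by
  obtain ⟨_, h⟩ := mem_val_image_supp.1 h
  obtain ⟨_, h'⟩ := mem_val_image_supp.1 h'
  exact h.symm.trans h'

lemma mem_val_image_supp_of_adj (h : v ∈ Subtype.val '' c.supp) (hw : w ∈ U) (hvw : G.Adj v w) :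
    w ∈ Subtype.val '' c.supp := by
  obtain ⟨hv, h⟩ := mem_val_image_supp.1 h
  refine mem_val_image_supp.2 ⟨hw, h ▸ ?_⟩
  exact SimpleGraph.ConnectedComponent.sound
    (SimpleGraph.Adj.reachable (G := G.induce U) (u := ⟨w, hw⟩) (v := ⟨v, hv⟩) hvw.symm)

end Components

section Decomposition

variable [Fintype V] {T : SimpleGraph V} {d : V → ℕ}

lemma mem_coreSet_of_adj {s v : V} (hs : s ∈ supportSet T) (h : T.Adj s v) : v ∈ coreSet T :=
  ⟨s, hs, h⟩

lemma notMem_coreSet (hS : IsIndep T (supportSet T)) {s : V} (hs : s ∈ supportSet T) :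
    s ∉ coreSet T :=
  fun ⟨t, ht, hts⟩ => hS t ht s hs hts

lemma notMem_supportSet_of_adj {r v : V} (hr : r ∈ (closedNbhd T (supportSet T))ᶜ)
    (h : T.Adj r v) : v ∉ supportSet T :=
  fun hv => hr (Or.inr ⟨v, hv, h.symm⟩)

lemma mem_trichotomy (T : SimpleGraph V) (v : V) :
    v ∈ supportSet T ∨ v ∈ coreSet T ∨ v ∈ (closedNbhd T (supportSet T))ᶜ := by
  by_cases h : v ∈ closedNbhd T (supportSet T)
  · exact h.elim Or.inl fun h => Or.inr (Or.inl h)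
  · exact Or.inr (Or.inr h)

/-- The vertices outside the closed neighborhood of the support in the color class given by `p`. -/
def outerClass (T : SimpleGraph V) (d : V → ℕ) (p : Prop) : Set V :=
  {v | v ∈ (closedNbhd T (supportSet T))ᶜ ∧ (Even (d v) ↔ p)}

lemma outerClass_disjoint_coreSet {p : Prop} : Disjoint (coreSet T) (outerClass T d p) :=
  Set.disjoint_left.2 fun _ h h' => h'.1 (Or.inr h)

lemma IsDepth.exists_isKonig (hd : IsDepth T d) (hT : T.IsAcyclic) :
    ∃ σ, ∀ p, IsKonig T (coreSet T ∪ outerClass T d p) σ := by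
  choose! σ hσS hσadj hσd using fun c (hc : c ∈ coreSet T) => hd.exists_child hc
  obtain ⟨τ, hτ⟩ := hd.exists_perm hT
  have hS := hd.isIndep_supportSet hT
  let ρ : V → V := fun v => if v ∈ coreSet T then σ v else
    if h : v ∈ (closedNbhd T (supportSet T))ᶜ then τ ⟨v, h⟩ else v
  have hρC : ∀ v ∈ coreSet T, ρ v = σ v := fun v hv => if_pos hv
  have hρR : ∀ v, ∀ h : v ∈ (closedNbhd T (supportSet T))ᶜ, ρ v = τ ⟨v, h⟩ := fun v h => by
    simp only [ρ]
    rw [if_neg fun hv : v ∈ coreSet T => h (Or.inr hv), dif_pos h]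
  refine ⟨ρ, fun p => ⟨?_, ?_, ?_, ?_⟩⟩
  · intro u v huv
    by_contra! hcon
    simp only [Set.mem_union, not_or] at hcon
    have hu : u ∉ supportSet T := fun h => hcon.2.1 (mem_coreSet_of_adj h huv)
    have hv : v ∉ supportSet T := fun h => hcon.1.1 (mem_coreSet_of_adj h huv.symm)
    have hu' := ((mem_trichotomy T u).resolve_left hu).resolve_left hcon.1.1
    have hv' := ((mem_trichotomy T v).resolve_left hv).resolve_left hcon.2.1
    have h1 : ¬ (Even (d u) ↔ p) := fun h => hcon.1.2 ⟨hu', h⟩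
    have h2 : ¬ (Even (d v) ↔ p) := fun h => hcon.2.2 ⟨hv', h⟩
    have := hd.even_iff huv
    tauto
  · rintro v (hv | hv)
    · rw [hρC v hv]
      exact hσadj v hv
    · rw [hρR v hv.1]
      exact hτ ⟨v, hv.1⟩
  · rintro v (hv | hv)
    · rw [hρC v hv]
      rintro (h | h)
      · exact notMem_coreSet hS (hσS v hv) h
      · exact h.1 (Or.inl (hσS v hv))
    · rw [hρR v hv.1]
      rintro (h | h)
      · exact (τ ⟨v, hv.1⟩).2 (Or.inr h)
      · have h1 := h.2
        have h2 := hv.2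
        have h3 := hd.even_iff (hτ ⟨v, hv.1⟩)
        simp only at h3
        tauto
  · rintro u (hu | hu) v (hv | hv) h
    · rw [hρC u hu, hρC v hv] at h
      have h1 := hσadj u hu
      have h2 := hσadj v hv
      have h3 := hσd u hu
      have h4 := hσd v hv
      rw [← h] at h2 h4
      exact hd.parent h1.symm h2.symm (by omega) (by omega)
    · rw [hρC u hu, hρR v hv.1] at h
      exact absurd (Or.inl (h ▸ hσS u hu)) (τ ⟨v, hv.1⟩).2
    · rw [hρC v hv, hρR u hu.1] at h
      exact absurd (Or.inl (h ▸ hσS v hv)) (τ ⟨u, hu.1⟩).2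
    · rw [hρR u hu.1, hρR v hv.1] at h
      exact congrArg Subtype.val (τ.injective (Subtype.ext h))

lemma IsDepth.ncard_outerClass_le (hd : IsDepth T d) (hT : T.IsAcyclic) {p q : Prop}
    (hpq : p ↔ ¬ q) : (outerClass T d p).ncard ≤ (outerClass T d q).ncard := by
  obtain ⟨τ, hτ⟩ := hd.exists_perm hT
  refine Set.ncard_le_ncard_of_injOn
    (fun v => if h : v ∈ (closedNbhd T (supportSet T))ᶜ then (τ ⟨v, h⟩ : V) else v) ?_ ?_
  · intro v hv
    rw [dif_pos hv.1]
    refine ⟨(τ ⟨v, hv.1⟩).2, ?_⟩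
    have h1 := hv.2
    have h2 := hd.even_iff (hτ ⟨v, hv.1⟩)
    simp only at h2
    tauto
  · intro u hu v hv h
    beta_reduce at h
    rw [dif_pos hu.1, dif_pos hv.1] at h
    exact congrArg Subtype.val (τ.injective (Subtype.ext h))

lemma IsDepth.ncard_outerClass (hd : IsDepth T d) (hT : T.IsAcyclic) (p : Prop) :
    (outerClass T d p).ncard = ((closedNbhd T (supportSet T))ᶜ).ncard / 2 := by
  have h1 : (outerClass T d p).ncard = (outerClass T d (¬ p)).ncard :=
    le_antisymm (hd.ncard_outerClass_le hT not_not.symm) (hd.ncard_outerClass_le hT Iff.rfl)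
  have h2 : (closedNbhd T (supportSet T))ᶜ = outerClass T d p ∪ outerClass T d (¬ p) := by
    ext v
    simp only [outerClass, Set.mem_union, Set.mem_ofPred_eq]
    tauto
  have h3 : Disjoint (outerClass T d p) (outerClass T d (¬ p)) :=
    Set.disjoint_left.2 fun v h h' => by
      have := h.2
      have := h'.2
      tauto
  rw [h2, Set.ncard_union_eq h3, ← h1]
  omega

lemma IsDepth.matchingNumber_eq (hd : IsDepth T d) (hT : T.IsAcyclic) :
    matchingNumber T = (coreSet T).ncard + ((closedNbhd T (supportSet T))ᶜ).ncard / 2 := by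
  obtain ⟨σ, hσ⟩ := hd.exists_isKonig hT
  rw [(hσ True).matchingNumber_eq, Set.ncard_union_eq outerClass_disjoint_coreSet,
    hd.ncard_outerClass hT]

lemma IsDepth.indepNumber_eq (hd : IsDepth T d) (hT : T.IsAcyclic) :
    indepNumber T = (supportSet T).ncard + ((closedNbhd T (supportSet T))ᶜ).ncard / 2 := by
  obtain ⟨σ, hσ⟩ := hd.exists_isKonig hT
  have hS := hd.isIndep_supportSet hT
  have h : (coreSet T ∪ outerClass T d True)ᶜ = supportSet T ∪ outerClass T d False := by
    ext v
    have h1 := mem_trichotomy T v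
    have h2 := fun h => notMem_coreSet hS (s := v) h
    have h3 : v ∈ (closedNbhd T (supportSet T))ᶜ → v ∉ supportSet T ∧ v ∉ coreSet T :=
      fun h => ⟨fun h' => h (Or.inl h'), fun h' => h (Or.inr h')⟩
    simp only [Set.mem_compl_iff (coreSet T ∪ _), Set.mem_union, outerClass, Set.mem_ofPred_eq]
    tauto
  rw [(hσ True).indepNumber_eq, h, Set.ncard_union_eq, hd.ncard_outerClass hT]
  exact Set.disjoint_left.2 fun _ h h' => h'.1 (Or.inl h)

/-- A matching of a forest is maximum if and only if it matches the core into the support and the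
vertices outside the closed neighborhood of the support among themselves. -/
lemma IsDepth.isMaxMatching_iff (hd : IsDepth T d) (hT : T.IsAcyclic) {M : Finset (Sym2 V)} :
    IsMaxMatching T M ↔ IsMatchingSet T M ∧ (∀ c ∈ coreSet T, ∃ s ∈ supportSet T, s(c, s) ∈ M) ∧
      ∀ r ∈ (closedNbhd T (supportSet T))ᶜ,
        ∃ r' ∈ (closedNbhd T (supportSet T))ᶜ, s(r, r') ∈ M := by
  obtain ⟨σ, hσ⟩ := hd.exists_isKonig hT
  have hS := hd.isIndep_supportSet hT
  constructor
  · intro h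
    obtain ⟨hM, h1⟩ := (hσ True).isMaxMatching_iff.1 h
    obtain ⟨-, h2⟩ := (hσ False).isMaxMatching_iff.1 h
    refine ⟨hM, ?_, ?_⟩
    · intro c hc
      obtain ⟨s, hs, hcs⟩ := h1 c (Or.inl hc)
      obtain ⟨t, ht, hct⟩ := h2 c (Or.inl hc)
      obtain rfl := hM.unique hcs hct
      refine ⟨s, ?_, hcs⟩
      by_contra hsS
      have hsR := ((mem_trichotomy T s).resolve_left hsS).resolve_left fun h => hs (Or.inl h)
      by_cases he : Even (d s)
      · exact hs (Or.inr ⟨hsR, by simpa using he⟩)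
      · exact ht (Or.inr ⟨hsR, by simpa using he⟩)
    · intro r hr
      obtain ⟨w, hw, hrw⟩ : ∃ w, w ∉ coreSet T ∧ s(r, w) ∈ M := by
        by_cases he : Even (d r)
        · obtain ⟨w, hw, hrw⟩ := h1 r (Or.inr ⟨hr, by simpa using he⟩)
          exact ⟨w, fun h => hw (Or.inl h), hrw⟩
        · obtain ⟨w, hw, hrw⟩ := h2 r (Or.inr ⟨hr, by simpa using he⟩)
          exact ⟨w, fun h => hw (Or.inl h), hrw⟩
      exact ⟨w, ((mem_trichotomy T w).resolve_left
        (notMem_supportSet_of_adj hr (hM.adj hrw))).resolve_left hw, hrw⟩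
  · rintro ⟨hM, hC, hR⟩
    refine (hσ True).isMaxMatching_iff.2 ⟨hM, ?_⟩
    rintro v (hv | hv)
    · obtain ⟨s, hs, hvs⟩ := hC v hv
      refine ⟨s, ?_, hvs⟩
      rintro (h | h)
      · exact notMem_coreSet hS hs h
      · exact h.1 (Or.inl hs)
    · obtain ⟨r, hr, hvr⟩ := hR v hv.1
      refine ⟨r, ?_, hvr⟩
      rintro (h | h)
      · exact hr (Or.inr h)
      · have h1 := hv.2
        have h2 := h.2
        have h3 := hd.even_iff (hM.adj hvr)
        tauto

/-- A matching of a component of the closed neighborhood of the support is maximum if and only if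
it matches the core vertices of the component into the support. -/
lemma IsDepth.isMaxMatching_component_iff (hd : IsDepth T d) (hT : T.IsAcyclic)
    (c : (T.induce (closedNbhd T (supportSet T))).ConnectedComponent)
    {N : Finset (Sym2 ↥(Subtype.val '' c.supp))} :
    IsMaxMatching (T.induce (Subtype.val '' c.supp)) N ↔
      IsMatchingSet (T.induce (Subtype.val '' c.supp)) N ∧
        ∀ k : ↥(Subtype.val '' c.supp), (k : V) ∈ coreSet T →
          ∃ s : ↥(Subtype.val '' c.supp), (s : V) ∈ supportSet T ∧ s(k, s) ∈ N := by
  choose! σ hσS hσadj hσd using fun c (hc : c ∈ coreSet T) => hd.exists_child hc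
  have hS := hd.isIndep_supportSet hT
  have hmem : ∀ k : ↥(Subtype.val '' c.supp), (k : V) ∈ coreSet T →
      σ k ∈ Subtype.val '' c.supp := fun k hk =>
    mem_val_image_supp_of_adj k.2 (Or.inl (hσS k hk)) (hσadj k hk)
  have hSC : ∀ k : ↥(Subtype.val '' c.supp), (k : V) ∉ coreSet T → (k : V) ∈ supportSet T :=
    fun k hk => (mem_of_mem_val_image_supp k.2).resolve_right hk
  let ρ : ↥(Subtype.val '' c.supp) → ↥(Subtype.val '' c.supp) := fun k =>
    if h : (k : V) ∈ coreSet T then ⟨σ k, hmem k h⟩ else k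
  have hρ : ∀ k : ↥(Subtype.val '' c.supp), (k : V) ∈ coreSet T → (ρ k : V) = σ k := by
    intro k hk
    simp only [ρ]
    rw [dif_pos hk]
  have hK : IsKonig (T.induce (Subtype.val '' c.supp))
      {k : ↥(Subtype.val '' c.supp) | (k : V) ∈ coreSet T} ρ := by
    refine ⟨?_, ?_, ?_, ?_⟩
    · intro u v huv
      by_contra! hcon
      exact hS u (hSC u hcon.1) v (hSC v hcon.2) huv
    · intro k hk
      change T.Adj k (ρ k)
      rw [hρ k hk]
      exact hσadj k hk
    · intro k hk h
      refine notMem_coreSet hS (hσS k hk) ?_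
      rw [← hρ k hk]
      exact h
    · intro u hu v hv h
      have h := congrArg Subtype.val h
      rw [hρ u hu, hρ v hv] at h
      have h1 := hσadj u hu
      have h2 := hσadj v hv
      have h3 := hσd u hu
      have h4 := hσd v hv
      rw [← h] at h2 h4
      exact Subtype.ext (hd.parent h1.symm h2.symm (by omega) (by omega))
  rw [hK.isMaxMatching_iff]
  refine and_congr_right fun _ => forall₂_congr fun k hk => exists_congr fun s => ?_
  refine and_congr_left fun _ => ⟨fun h => hSC s h, fun h => notMem_coreSet hS h⟩

end Decomposition

section Counting

/-- The edges of `M` with both ends in `P`. -/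
noncomputable def restrictEdges [Fintype V] (M : Finset (Sym2 V)) (P : Set V) : Finset (Sym2 P) :=
  Finset.univ.filter fun e => e.map Subtype.val ∈ M

lemma mk_mem_restrictEdges [Fintype V] {M : Finset (Sym2 V)} {P : Set V} {a b : P} :
    s(a, b) ∈ restrictEdges M P ↔ s((a : V), (b : V)) ∈ M := by
  simp [restrictEdges]

variable [Fintype V] {T : SimpleGraph V} {d : V → ℕ}

lemma IsMatchingSet.restrictEdges {M : Finset (Sym2 V)} (hM : IsMatchingSet T M) (P : Set V) :
    IsMatchingSet (T.induce P) (restrictEdges M P) := by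
  refine isMatchingSet_iff.2 ⟨fun a b h => hM.adj (mk_mem_restrictEdges.1 h), ?_⟩
  intro a b c hb hc
  exact Subtype.ext (hM.unique (mk_mem_restrictEdges.1 hb) (mk_mem_restrictEdges.1 hc))

lemma IsDepth.isMaxMatching_restrictEdges (hd : IsDepth T d) (hT : T.IsAcyclic)
    {M : Finset (Sym2 V)} (hM : IsMaxMatching T M)
    (c : (T.induce (closedNbhd T (supportSet T))).ConnectedComponent) :
    IsMaxMatching (T.induce (Subtype.val '' c.supp)) (restrictEdges M (Subtype.val '' c.supp)) := by
  obtain ⟨hM, hC, -⟩ := (hd.isMaxMatching_iff hT).1 hM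
  refine (hd.isMaxMatching_component_iff hT c).2 ⟨hM.restrictEdges _, fun k hk => ?_⟩
  obtain ⟨s, hs, hks⟩ := hC k hk
  exact ⟨⟨s, mem_val_image_supp_of_adj k.2 (Or.inl hs) (hM.adj hks)⟩, hs,
    mk_mem_restrictEdges.2 hks⟩

lemma IsDepth.subset_of_restrictEdges_eq (hd : IsDepth T d) (hT : T.IsAcyclic)
    {M M' : Finset (Sym2 V)} (hM : IsMaxMatching T M) (hM' : IsMaxMatching T M')
    (h : ∀ c : (T.induce (closedNbhd T (supportSet T))).ConnectedComponent,
      restrictEdges M (Subtype.val '' c.supp) = restrictEdges M' (Subtype.val '' c.supp)) :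
    M ⊆ M' := by
  obtain ⟨hM, hC, hR⟩ := (hd.isMaxMatching_iff hT).1 hM
  obtain ⟨hM', -, hR'⟩ := (hd.isMaxMatching_iff hT).1 hM'
  have hcore : ∀ a b, a ∈ coreSet T → s(a, b) ∈ M → s(a, b) ∈ M' := by
    intro a b ha hab
    obtain ⟨s, hs, has⟩ := hC a ha
    obtain rfl := hM.unique hab has
    obtain ⟨c, hc⟩ := exists_mem_val_image_supp (G := T)
      (U := closedNbhd T (supportSet T)) (Or.inr ha)
    have hb := mem_val_image_supp_of_adj hc (Or.inl hs) (hM.adj hab)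
    have h1 : s((⟨a, hc⟩ : ↥(Subtype.val '' c.supp)), ⟨b, hb⟩) ∈
        restrictEdges M (Subtype.val '' c.supp) := mk_mem_restrictEdges.2 hab
    rw [h c] at h1
    exact mk_mem_restrictEdges.1 h1
  intro e he
  induction e with
  | _ a b =>
    rcases mem_trichotomy T a with ha | ha | ha
    · rw [Sym2.eq_swap] at he ⊢
      exact hcore b a (mem_coreSet_of_adj ha (hM.adj he).symm) he
    · exact hcore a b ha he
    · exact hd.matching_unique hM hM' hR hR' ha he

lemma IsDepth.exists_restrictEdges_eq (hd : IsDepth T d) (hT : T.IsAcyclic)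
    (N : ∀ c : (T.induce (closedNbhd T (supportSet T))).ConnectedComponent,
      Finset (Sym2 ↥(Subtype.val '' c.supp)))
    (hN : ∀ c, IsMaxMatching (T.induce (Subtype.val '' c.supp)) (N c)) :
    ∃ M, IsMaxMatching T M ∧ ∀ c, restrictEdges M (Subtype.val '' c.supp) = N c := by
  obtain ⟨σ, hσ⟩ := hd.exists_isKonig hT
  obtain ⟨M₀, hM₀⟩ := (hσ True).exists_isMaxMatching
  obtain ⟨hM₀, -, hR₀⟩ := (hd.isMaxMatching_iff hT).1 hM₀
  have hN' := fun c => (hd.isMaxMatching_component_iff hT c).1 (hN c)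
  let M : Finset (Sym2 V) := Finset.univ.filter fun e =>
    (∃ c, ∃ f ∈ N c, f.map Subtype.val = e) ∨
      e ∈ M₀ ∧ ∀ v ∈ e, v ∈ (closedNbhd T (supportSet T))ᶜ
  have hmem : ∀ a b, s(a, b) ∈ M ↔
      (∃ c, ∃ ha : a ∈ Subtype.val '' c.supp, ∃ hb : b ∈ Subtype.val '' c.supp,
        s((⟨a, ha⟩ : ↥(Subtype.val '' c.supp)), ⟨b, hb⟩) ∈ N c) ∨
      s(a, b) ∈ M₀ ∧ a ∈ (closedNbhd T (supportSet T))ᶜ ∧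
        b ∈ (closedNbhd T (supportSet T))ᶜ := by
    intro a b
    simp only [M, Finset.mem_filter, Finset.mem_univ, true_and, Sym2.ball]
    refine or_congr_left (exists_congr fun c => ⟨?_, ?_⟩)
    · rintro ⟨f, hf, hfe⟩
      induction f with
      | _ x y =>
        rcases Sym2.eq_iff.1 hfe with ⟨rfl, rfl⟩ | ⟨rfl, rfl⟩
        · exact ⟨x.2, y.2, hf⟩
        · exact ⟨y.2, x.2, Sym2.eq_swap ▸ hf⟩
    · rintro ⟨ha, hb, h⟩
      exact ⟨_, h, rfl⟩
  have hM : IsMatchingSet T M := by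
    refine isMatchingSet_iff.2 ⟨fun a b h => ?_, fun a b b' hb hb' => ?_⟩
    · rcases (hmem a b).1 h with ⟨c, ha, hb, h⟩ | ⟨h, -, -⟩
      · exact (hN c).1.adj h
      · exact hM₀.adj h
    · rcases (hmem a b).1 hb with ⟨c, ha, hb, h⟩ | ⟨h, ha, -⟩ <;>
        rcases (hmem a b').1 hb' with ⟨c', ha', hb', h'⟩ | ⟨h', ha', -⟩
      · obtain rfl := eq_of_mem_val_image_supp ha ha'
        exact congrArg Subtype.val ((hN c).1.unique h h')
      · exact absurd (mem_of_mem_val_image_supp ha) ha'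
      · exact absurd (mem_of_mem_val_image_supp ha') ha
      · exact hM₀.unique h h'
  refine ⟨M, (hd.isMaxMatching_iff hT).2 ⟨hM, ?_, ?_⟩, ?_⟩
  · intro k hk
    obtain ⟨c, hc⟩ := exists_mem_val_image_supp (G := T)
      (U := closedNbhd T (supportSet T)) (Or.inr hk)
    obtain ⟨s, hs, hks⟩ := (hN' c).2 ⟨k, hc⟩ hk
    exact ⟨s, hs, (hmem k s).2 (Or.inl ⟨c, hc, s.2, hks⟩)⟩
  · intro r hr
    obtain ⟨r', hr', hrr'⟩ := hR₀ r hr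
    exact ⟨r', hr', (hmem r r').2 (Or.inr ⟨hrr', hr, hr'⟩)⟩
  · intro c
    ext f
    induction f with
    | _ x y =>
      rw [mk_mem_restrictEdges, hmem]
      constructor
      · rintro (⟨c', hx, hy, h⟩ | ⟨-, hx, -⟩)
        · obtain rfl := eq_of_mem_val_image_supp hx x.2
          exact h
        · exact absurd (mem_of_mem_val_image_supp x.2) hx
      · intro h
        exact Or.inl ⟨c, x.2, y.2, h⟩

lemma IsDepth.numMaxMatchings_eq (hd : IsDepth T d) (hT : T.IsAcyclic) :
    numMaxMatchings T =
      ∏ c : (T.induce (closedNbhd T (supportSet T))).ConnectedComponent,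
        numMaxMatchings (T.induce (Subtype.val '' c.supp)) := by
  simp only [numMaxMatchings, ← Nat.card_coe_set_eq]
  rw [← Nat.card_pi]
  refine Nat.card_eq_of_bijective
    (fun M c => ⟨restrictEdges M.1 _, hd.isMaxMatching_restrictEdges hT M.2 c⟩) ⟨?_, ?_⟩
  · intro M M' h
    have h' := fun c => congrArg Subtype.val (congrFun h c)
    exact Subtype.ext ((hd.subset_of_restrictEdges_eq hT M.2 M'.2 h').antisymm
      (hd.subset_of_restrictEdges_eq hT M'.2 M.2 fun c => (h' c).symm))
  · intro N
    obtain ⟨M, hM, h⟩ := hd.exists_restrictEdges_eq hT (fun c => (N c).1) fun c => (N c).2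
    exact ⟨⟨M, hM⟩, funext fun c => Subtype.ext (h c)⟩

end Counting

/-- Formulas for the matching number and independence number of a tree in terms of
its null decomposition, and the factorization of the number of maximum matchings
over the S-components. -/
theorem stmt19 [Fintype V] (T : SimpleGraph V) (hT : T.IsTree) :
    matchingNumber T = (coreSet T).ncard + ((closedNbhd T (supportSet T))ᶜ).ncard / 2 ∧
    indepNumber T = (supportSet T).ncard + ((closedNbhd T (supportSet T))ᶜ).ncard / 2 ∧
    numMaxMatchings T =
      ∏ c : (T.induce (closedNbhd T (supportSet T))).ConnectedComponent,
        numMaxMatchings (T.induce (Subtype.val '' c.supp)) := by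
  obtain ⟨d, hd⟩ := exists_isDepth hT
  exact ⟨hd.matchingNumber_eq hT.isAcyclic, hd.indepNumber_eq hT.isAcyclic,
    hd.numMaxMatchings_eq hT.isAcyclic⟩

end NullDecomp
end
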